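/- arXiv:math/9909083 — 6 statements merged into one kernel-verified Lean document; each statement's English description precedes it below -/
import Mathlib

section
/- Let m ∈ ℝ, m ≠ 0, and let v : ℝ → ℂ be a twice continuously differentiable solution of −v'' + m v − |v|²v + |v|⁴v = 0 on ℝ which does not vanish identically and satisfies v(y) → 0 as |y| → ∞. Then the argument of v is constant: there exist θ₀ ∈ ℝ and a real-valued function w : ℝ → ℝ such that v = e^{iθ₀} w on ℝ. Moreover, necessarily m > 0. -/
open Filter

/-- A solution of the linear equation `f'' = q f` with continuous `q` and vanishing Cauchy data
at one point is identically zero. -/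
theorem eq_zero_of_second_order_linear {f g q : ℝ → ℝ} (hq : Continuous q)
    (hf : ∀ x, HasDerivAt f (g x) x) (hg : ∀ x, HasDerivAt g (q x * f x) x)
    {x₀ : ℝ} (hf₀ : f x₀ = 0) (hg₀ : g x₀ = 0) (x : ℝ) : f x = 0 := by
  have hx : x ∈ Set.Ioo (min x x₀ - 1) (max x x₀ + 1) := by grind
  have hx₀ : x₀ ∈ Set.Ioo (min x x₀ - 1) (max x x₀ + 1) := by grind
  generalize min x x₀ - 1 = a at hx hx₀
  generalize max x x₀ + 1 = b at hx hx₀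
  obtain ⟨C, hC⟩ := (isCompact_Icc (a := a) (b := b)).exists_bound_of_continuousOn hq.continuousOn
  have hlip : ∀ t ∈ Set.Ioo a b, LipschitzOnWith (max 1 C.toNNReal)
      (fun p : ℝ × ℝ => (p.2, q t * p.1)) Set.univ := by
    intro t ht
    have hqt : ‖q t‖₊ ≤ C.toNNReal := by
      rw [← NNReal.coe_le_coe, coe_nnnorm]
      exact (hC t (Set.Ioo_subset_Icc_self ht)).trans (Real.le_coe_toNNReal C)
    have h₁ : LipschitzWith C.toNNReal (fun p : ℝ × ℝ => q t * p.1) := by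
      have h := ((lipschitzWith_smul (q t)).weaken hqt).comp
        (LipschitzWith.prod_fst (α := ℝ) (β := ℝ))
      rwa [mul_one] at h
    exact (LipschitzWith.prod_snd.prodMk h₁).lipschitzOnWith
  have key := ODE_solution_unique_of_mem_Ioo (f := fun t => (f t, g t)) (g := fun _ => (0, 0))
    hlip hx₀ (fun t _ => ⟨(hf t).prodMk (hg t), trivial⟩)
    (fun t _ => ⟨(hasDerivAt_const t ((0, 0) : ℝ × ℝ)).congr_deriv (by simp; rfl), trivial⟩)
    (by simp [hf₀, hg₀]) hx
  exact congrArg Prod.fst key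

/-- Conservation of angular momentum for a planar central force field. -/
theorem angular_momentum_const {a b c d q : ℝ → ℝ}
    (ha : ∀ x, HasDerivAt a (c x) x) (hb : ∀ x, HasDerivAt b (d x) x)
    (hc : ∀ x, HasDerivAt c (q x * a x) x) (hd : ∀ x, HasDerivAt d (q x * b x) x) (x y : ℝ) :
    a x * d x - b x * c x = a y * d y - b y * c y := by
  have h : ∀ t, HasDerivAt (fun t => a t * d t - b t * c t) 0 t := fun t => by
    refine (((ha t).mul (hd t)).sub ((hb t).mul (hc t))).congr_deriv ?_
    ring
  exact is_const_of_deriv_eq_zero (fun t => (h t).differentiableAt) (fun t => (h t).deriv) x y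

/-- Conservation of energy for the planar form of the cubic-quintic equation. -/
theorem exists_energy_const {m : ℝ} {a b c d : ℝ → ℝ}
    (ha : ∀ x, HasDerivAt a (c x) x) (hb : ∀ x, HasDerivAt b (d x) x)
    (hc : ∀ x, HasDerivAt c ((m - (a x ^ 2 + b x ^ 2) + (a x ^ 2 + b x ^ 2) ^ 2) * a x) x)
    (hd : ∀ x, HasDerivAt d ((m - (a x ^ 2 + b x ^ 2) + (a x ^ 2 + b x ^ 2) ^ 2) * b x) x) :
    ∃ E : ℝ, ∀ x, c x ^ 2 + d x ^ 2 = E + (a x ^ 2 + b x ^ 2) *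
      (m - (a x ^ 2 + b x ^ 2) / 2 + (a x ^ 2 + b x ^ 2) ^ 2 / 3) := by
  have h : ∀ t, HasDerivAt (fun t => c t ^ 2 + d t ^ 2 - (a t ^ 2 + b t ^ 2) *
      (m - (a t ^ 2 + b t ^ 2) / 2 + (a t ^ 2 + b t ^ 2) ^ 2 / 3)) 0 t := fun t => by
    have hρ := ((ha t).pow 2).add ((hb t).pow 2)
    refine ((((hc t).pow 2).add ((hd t).pow 2)).sub
      (hρ.mul (((hρ.div_const 2).const_sub m).add ((hρ.pow 2).div_const 3)))).congr_deriv ?_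
    simp
    ring
  refine ⟨c 0 ^ 2 + d 0 ^ 2 - (a 0 ^ 2 + b 0 ^ 2) *
      (m - (a 0 ^ 2 + b 0 ^ 2) / 2 + (a 0 ^ 2 + b 0 ^ 2) ^ 2 / 3), fun x => ?_⟩
  have := is_const_of_deriv_eq_zero (fun t => (h t).differentiableAt) (fun t => (h t).deriv) x 0
  linarith

/-- The energy identity forces `c² + d²` to converge to the energy when `a, b → 0`. -/
theorem exists_tendsto_kinetic {m : ℝ} {a b c d : ℝ → ℝ}
    (ha : ∀ x, HasDerivAt a (c x) x) (hb : ∀ x, HasDerivAt b (d x) x)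
    (hc : ∀ x, HasDerivAt c ((m - (a x ^ 2 + b x ^ 2) + (a x ^ 2 + b x ^ 2) ^ 2) * a x) x)
    (hd : ∀ x, HasDerivAt d ((m - (a x ^ 2 + b x ^ 2) + (a x ^ 2 + b x ^ 2) ^ 2) * b x) x)
    (ha₀ : Tendsto a atTop (nhds 0)) (hb₀ : Tendsto b atTop (nhds 0)) :
    ∃ E : ℝ, (∀ x, c x ^ 2 + d x ^ 2 = E + (a x ^ 2 + b x ^ 2) *
      (m - (a x ^ 2 + b x ^ 2) / 2 + (a x ^ 2 + b x ^ 2) ^ 2 / 3)) ∧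
      Tendsto (fun x => c x ^ 2 + d x ^ 2) atTop (nhds E) := by
  obtain ⟨E, hE⟩ := exists_energy_const ha hb hc hd
  refine ⟨E, hE, ?_⟩
  have hρ := (ha₀.pow 2).add (hb₀.pow 2)
  have := (hρ.mul (((hρ.div_const 2).const_sub m).add ((hρ.pow 2).div_const 3))).const_add E
  simpa [hE] using this

/-- Planar solutions vanishing at `+∞` have zero angular momentum. -/
theorem angular_momentum_eq_zero {m : ℝ} {a b c d : ℝ → ℝ}
    (ha : ∀ x, HasDerivAt a (c x) x) (hb : ∀ x, HasDerivAt b (d x) x)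
    (hc : ∀ x, HasDerivAt c ((m - (a x ^ 2 + b x ^ 2) + (a x ^ 2 + b x ^ 2) ^ 2) * a x) x)
    (hd : ∀ x, HasDerivAt d ((m - (a x ^ 2 + b x ^ 2) + (a x ^ 2 + b x ^ 2) ^ 2) * b x) x)
    (ha₀ : Tendsto a atTop (nhds 0)) (hb₀ : Tendsto b atTop (nhds 0)) (x : ℝ) :
    a x * d x - b x * c x = 0 := by
  obtain ⟨E, -, hlim⟩ := exists_tendsto_kinetic ha hb hc hd ha₀ hb₀
  have hbound : Tendsto (fun y => (a y ^ 2 + b y ^ 2) * (c y ^ 2 + d y ^ 2)) atTop (nhds 0) := by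
    simpa using ((ha₀.pow 2).add (hb₀.pow 2)).mul hlim
  have hle : (a x * d x - b x * c x) ^ 2 ≤ 0 := by
    refine ge_of_tendsto' hbound fun y => ?_
    rw [angular_momentum_const ha hb hc hd x y]
    nlinarith [sq_nonneg (a y * c y + b y * d y)]
  exact pow_eq_zero_iff two_ne_zero |>.mp (le_antisymm hle (sq_nonneg _))

/-- If a function tends to `0` at `+∞` and the square of its derivative converges there, then that
limit is `0`. -/
theorem eq_zero_of_tendsto_sq_deriv {w s : ℝ → ℝ} {E : ℝ} (hw : ∀ x, HasDerivAt w (s x) x)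
    (hw₀ : Tendsto w atTop (nhds 0)) (hs : Tendsto (fun x => s x ^ 2) atTop (nhds E)) :
    E = 0 := by
  have hslope : ∀ x : ℝ, ∃ ξ ∈ Set.Ioo x (x + 1), s ξ = w (x + 1) - w x := fun x => by
    obtain ⟨ξ, hξ, h⟩ := exists_hasDerivAt_eq_slope w s (lt_add_one x)
      (fun y _ => (hw y).continuousAt.continuousWithinAt) (fun y _ => hw y)
    exact ⟨ξ, hξ, by simpa using h⟩
  choose ξ hξ hsξ using hslope
  have hξ_top : Tendsto ξ atTop atTop := tendsto_atTop_mono (fun x => (hξ x).1.le) tendsto_id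
  refine tendsto_nhds_unique (hs.comp hξ_top) ?_
  have h := ((hw₀.comp (tendsto_atTop_add_const_right atTop (1 : ℝ) tendsto_id)).sub hw₀).pow 2
  simpa [Function.comp_def, hsξ] using h

/-- A nontrivial real solution of `w'' = (m - w² + w⁴) w` vanishing at `+∞` exists only if
`m ≥ 0`. -/
theorem nonneg_of_real_solution {m : ℝ} {w s : ℝ → ℝ} (hw : ∀ x, HasDerivAt w (s x) x)
    (hs : ∀ x, HasDerivAt s ((m - w x ^ 2 + (w x ^ 2) ^ 2) * w x) x)
    (hw₀ : Tendsto w atTop (nhds 0)) (hnz : ∃ x, w x ≠ 0) : 0 ≤ m := by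
  obtain ⟨E, hE, hlim⟩ := exists_tendsto_kinetic (m := m) (a := w) (b := fun _ => 0) (c := s)
    (d := fun _ => 0) hw (fun x => hasDerivAt_const x 0) (by simpa using hs)
    (by simpa using fun x => hasDerivAt_const x (0 : ℝ)) hw₀ tendsto_const_nhds
  simp only [ne_eq, OfNat.ofNat_ne_zero, not_false_eq_true, zero_pow, add_zero] at hE hlim
  obtain rfl := eq_zero_of_tendsto_sq_deriv hw hw₀ hlim
  by_contra! hm
  have hfactor : Tendsto (fun x => m - w x ^ 2 / 2 + (w x ^ 2) ^ 2 / 3) atTop (nhds m) := by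
    simpa using (((hw₀.pow 2).div_const 2).const_sub m).add (((hw₀.pow 2).pow 2).div_const 3)
  obtain ⟨x, hx⟩ := (hfactor.eventually_lt_const hm).exists
  have hwx : w x = 0 := by
    by_contra h
    nlinarith [hE x, sq_nonneg (s x), mul_neg_of_pos_of_neg (by positivity : 0 < w x ^ 2) hx]
  have hsx : s x = 0 := by simpa [hwx] using hE x
  obtain ⟨y, hy⟩ := hnz
  have hwc : Continuous w := continuous_iff_continuousAt.2 fun x => (hw x).continuousAt
  exact hy (eq_zero_of_second_order_linear (by fun_prop) hw hs hwx hsx y)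

/-- A nontrivial `C²` solution of `−v'' + m v − |v|²v + |v|⁴v = 0` on `ℝ`
(with `m ≠ 0`) tending to `0` at infinity has constant argument: `v = e^{iθ₀} w` with `w`
real-valued; moreover necessarily `m > 0`. -/
theorem constant_argument_and_m_pos (m : ℝ) (hm : m ≠ 0) (v : ℝ → ℂ)
    (hv : ContDiff ℝ 2 v)
    (heq : ∀ x : ℝ, -iteratedDeriv 2 v x + (m : ℂ) * v x
      - (‖v x‖ : ℂ) ^ 2 * v x + (‖v x‖ : ℂ) ^ 4 * v x = 0)
    (hnz : ∃ x : ℝ, v x ≠ 0)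
    (hlim : Tendsto v (cocompact ℝ) (nhds 0)) :
    (∃ θ₀ : ℝ, ∃ w : ℝ → ℝ, ∀ x : ℝ,
      v x = Complex.exp ((θ₀ : ℂ) * Complex.I) * (w x : ℂ)) ∧ 0 < m := by
  have hv₁ : ∀ x, HasDerivAt v (deriv v x) x := fun x =>
    (hv.differentiable (by norm_num) x).hasDerivAt
  have hdv : ContDiff ℝ 1 (deriv v) := ((contDiff_succ_iff_deriv (n := 1)).1 hv).2.2
  have hv₂ : ∀ x, HasDerivAt (deriv v)
      (((m - ‖v x‖ ^ 2 + (‖v x‖ ^ 2) ^ 2 : ℝ) : ℂ) * v x) x := fun x => by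
    have h := (hdv.differentiable (by norm_num) x).hasDerivAt
    have h2 := heq x
    rw [iteratedDeriv_succ, iteratedDeriv_one] at h2
    refine h.congr_deriv ?_
    push_cast
    linear_combination -h2
  have hnorm : ∀ x, ‖v x‖ ^ 2 = (v x).re ^ 2 + (v x).im ^ 2 := fun x => by
    rw [← Complex.normSq_eq_norm_sq, Complex.normSq_apply]; ring
  have ha : ∀ x, HasDerivAt (fun x => (v x).re) (deriv v x).re x := fun x =>
    Complex.reCLM.hasFDerivAt.comp_hasDerivAt x (hv₁ x)
  have hb : ∀ x, HasDerivAt (fun x => (v x).im) (deriv v x).im x := fun x =>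
    Complex.imCLM.hasFDerivAt.comp_hasDerivAt x (hv₁ x)
  have hc : ∀ x, HasDerivAt (fun x => (deriv v x).re) ((m - ((v x).re ^ 2 + (v x).im ^ 2)
      + ((v x).re ^ 2 + (v x).im ^ 2) ^ 2) * (v x).re) x := fun x => by
    have h := Complex.reCLM.hasFDerivAt.comp_hasDerivAt x (hv₂ x)
    rwa [Complex.reCLM_apply, Complex.re_ofReal_mul, hnorm] at h
  have hd : ∀ x, HasDerivAt (fun x => (deriv v x).im) ((m - ((v x).re ^ 2 + (v x).im ^ 2)
      + ((v x).re ^ 2 + (v x).im ^ 2) ^ 2) * (v x).im) x := fun x => by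
    have h := Complex.imCLM.hasFDerivAt.comp_hasDerivAt x (hv₂ x)
    rwa [Complex.imCLM_apply, Complex.im_ofReal_mul, hnorm] at h
  have hlim_top : Tendsto v atTop (nhds 0) := hlim.mono_left atTop_le_cocompact
  have ha₀ : Tendsto (fun x => (v x).re) atTop (nhds 0) :=
    (Complex.continuous_re.tendsto 0).comp hlim_top
  have hb₀ : Tendsto (fun x => (v x).im) atTop (nhds 0) :=
    (Complex.continuous_im.tendsto 0).comp hlim_top
  have hvc : Continuous v := hv.continuous
  obtain ⟨x₀, hx₀⟩ := hnz
  have hJ := angular_momentum_eq_zero ha hb hc hd ha₀ hb₀ x₀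
  generalize hα : (v x₀).re = α at hJ
  generalize hβ : (v x₀).im = β at hJ
  have hr : 0 < ‖v x₀‖ := norm_pos_iff.2 hx₀
  have hr2 : ‖v x₀‖ ^ 2 = α ^ 2 + β ^ 2 := by rw [hnorm, hα, hβ]
  have hexp : Complex.exp (((v x₀).arg : ℂ) * Complex.I) = v x₀ / ‖v x₀‖ := by
    rw [eq_div_iff (by exact_mod_cast hr.ne'), mul_comm, Complex.norm_mul_exp_arg_mul_I]
  have hprop : ∀ x, α * (v x).im - β * (v x).re = 0 :=
    eq_zero_of_second_order_linear
      (q := fun x => m - ((v x).re ^ 2 + (v x).im ^ 2) + ((v x).re ^ 2 + (v x).im ^ 2) ^ 2)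
      (by fun_prop) (fun x => ((hb x).const_mul α).sub ((ha x).const_mul β))
      (fun x => by
        refine (((hd x).const_mul α).sub ((hc x).const_mul β)).congr_deriv ?_
        ring)
      (x₀ := x₀) (by rw [hα, hβ]; ring) hJ
  generalize hrdef : ‖v x₀‖ = r at hr hr2 hexp
  refine ⟨⟨(v x₀).arg, fun x => (α * (v x).re + β * (v x).im) / r, fun x => ?_⟩, ?_⟩
  · have hp := hprop x
    rw [hexp, show v x₀ / (r : ℂ) * ((α * (v x).re + β * (v x).im) / r : ℝ)
      = ((((α * (v x).re + β * (v x).im) / r ^ 2 : ℝ)) : ℂ) * v x₀ by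
        push_cast; field_simp]
    apply Complex.ext
    · rw [Complex.re_ofReal_mul, hα]
      field_simp
      rw [hr2]
      linear_combination (-β) * hp
    · rw [Complex.im_ofReal_mul, hβ]
      field_simp
      rw [hr2]
      linear_combination α * hp
  · refine lt_of_le_of_ne (nonneg_of_real_solution
      (w := fun x => (α * (v x).re + β * (v x).im) / r)
      (fun x => (((ha x).const_mul α).add ((hb x).const_mul β)).div_const r) (fun x => ?_) ?_
      ⟨x₀, ?_⟩) hm.symm
    · have hsq : ((α * (v x).re + β * (v x).im) / r) ^ 2 = (v x).re ^ 2 + (v x).im ^ 2 := by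
        rw [div_pow, hr2, div_eq_iff (by rw [← hr2]; positivity)]
        linear_combination -(α * (v x).im - β * (v x).re) * hprop x
      refine ((((hc x).const_mul α).add ((hd x).const_mul β)).div_const r).congr_deriv ?_
      rw [hsq]
      ring
    · simpa using ((ha₀.const_mul α).add (hb₀.const_mul β)).div_const r
    · rw [hα, hβ, show α * α + β * β = r ^ 2 by rw [hr2]; ring]
      positivity
end

section
/- Let m > 0 and suppose there exists a real-valued twice continuously differentiable solution u of −m u'' + m u − u³ + u⁵ = 0 on ℝ, not identically zero, with u(x) → 0 as |x| → ∞. Then necessarily m < 3/16. Moreover, writing m = (3/16)(1−ν) with ν ∈ (0,1), the function r(x) = √( (3/4)(1−ν)/(1+√ν·cosh(2x)) ) is a positive even solution of −m r'' + m r − r³ + r⁵ = 0 vanishing at infinity, and it is the unique such solution: every positive solution of this equation tending to 0 at ±∞ is a translate x ↦ r(x − x₀) of r. -/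
open Filter

/-- If `u` tends to zero at infinity and the square of its derivative converges, then the limit
of the latter is zero. -/
lemma eq_zero_of_hasDerivAt_of_sq_tendsto {u v : ℝ → ℝ} {L : ℝ}
    (huv : ∀ x, HasDerivAt u (v x) x) (hu : Tendsto u atTop (nhds 0))
    (hv : Tendsto (fun x => v x ^ 2) atTop (nhds L)) : L = 0 := by
  have hmvt : ∀ x : ℝ, ∃ c, x < c ∧ v c = u (x + 1) - u x := by
    intro x
    obtain ⟨c, hc, h⟩ := exists_hasDerivAt_eq_slope u v (lt_add_one x)
      (fun y _ => (huv y).continuousAt.continuousWithinAt) (fun y _ => huv y)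
    exact ⟨c, hc.1, by rw [h]; simp⟩
  choose c hc hvc using hmvt
  have hcT : Tendsto c atTop atTop := tendsto_atTop_mono (fun x => (hc x).le) tendsto_id
  have h1 := hv.comp hcT
  have h2 : Tendsto (fun x => (u (x + 1) - u x) ^ 2) atTop (nhds ((0 - 0) ^ 2)) :=
    ((hu.comp (tendsto_atTop_add_const_right _ 1 tendsto_id)).sub hu).pow 2
  have h3 : ((fun x => v x ^ 2) ∘ c) = fun x => (u (x + 1) - u x) ^ 2 := by
    funext x; simp [hvc]
  rw [h3] at h1
  simpa using tendsto_nhds_unique h1 h2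

/-- A nonnegative function with `|f'| ≤ C f` that is positive somewhere is positive everywhere. -/
lemma pos_of_abs_deriv_le {f f' : ℝ → ℝ} {C : ℝ} (hf : ∀ x, HasDerivAt f (f' x) x)
    (hC : ∀ x, |f' x| ≤ C * f x) {x₀ : ℝ} (h₀ : 0 < f x₀) (x : ℝ) : 0 < f x := by
  have hexp : ∀ K y : ℝ, HasDerivAt (fun z => f z * Real.exp (K * z))
      ((f' y + K * f y) * Real.exp (K * y)) y := by
    intro K y
    have h := (hf y).mul ((hasDerivAt_id y).const_mul K).exp
    refine h.congr_deriv ?_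
    simp only [id]; ring
  rcases le_total x₀ x with h | h
  · have hmono : Monotone fun z => f z * Real.exp (C * z) :=
      monotone_of_hasDerivAt_nonneg (hexp C) fun y =>
        mul_nonneg (by linarith [neg_le_of_abs_le (hC y)]) (Real.exp_pos _).le
    have := hmono h
    exact pos_of_mul_pos_left ((mul_pos h₀ (Real.exp_pos _)).trans_le this) (Real.exp_pos _).le
  · have hanti : Antitone fun z => f z * Real.exp (-C * z) :=
      antitone_of_hasDerivAt_nonpos (hexp (-C)) fun y =>
        mul_nonpos_of_nonpos_of_nonneg (by linarith [le_of_abs_le (hC y)]) (Real.exp_pos _).le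
    have := hanti h
    exact pos_of_mul_pos_left ((mul_pos h₀ (Real.exp_pos _)).trans_le this) (Real.exp_pos _).le

/-- Solutions of `p'' = 4 p` are combinations of `exp (2 x)` and `exp (-2 x)`. -/
lemma exists_eq_exp_of_deriv_deriv_eq {p p' : ℝ → ℝ} (hp : ∀ x, HasDerivAt p (p' x) x)
    (hp' : ∀ x, HasDerivAt p' (4 * p x) x) :
    ∃ a b : ℝ, ∀ x, p x = a * Real.exp (2 * x) + b * Real.exp (-(2 * x)) ∧
      p' x = 2 * a * Real.exp (2 * x) - 2 * b * Real.exp (-(2 * x)) := by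
  have hconst : ∀ K : ℝ, K ^ 2 = 4 → ∀ x,
      (p' x + K * p x) * Real.exp (-(K * x)) = p' 0 + K * p 0 := by
    intro K hK x
    have hd : ∀ y, HasDerivAt (fun z => (p' z + K * p z) * Real.exp (-(K * z))) 0 y := by
      intro y
      have h := ((hp' y).add ((hp y).const_mul K)).mul ((hasDerivAt_id y).const_mul K).neg.exp
      refine h.congr_deriv ?_
      simp only [id, Pi.add_apply]
      linear_combination (-p y * Real.exp (-(K * y))) * hK
    have := is_const_of_deriv_eq_zero (fun y => (hd y).differentiableAt)
      (fun y => (hd y).deriv) x 0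
    simpa using this
  refine ⟨(p' 0 + 2 * p 0) / 4, -(p' 0 + -2 * p 0) / 4, fun x => ?_⟩
  have h1 := hconst 2 (by norm_num) x
  have h2 := hconst (-2) (by norm_num) x
  rw [show -(-2 * x) = 2 * x by ring] at h2
  rw [← h1, ← h2]
  have he : Real.exp (2 * x) * Real.exp (-(2 * x)) = 1 := by
    rw [← Real.exp_add]; simp
  constructor
  · linear_combination (-p x) * he
  · linear_combination (-p' x) * he

/-- If `c + a exp (2 x) + b exp (-2 x)` tends to infinity at infinity then `a > 0`. -/
lemma pos_of_tendsto_exp_atTop {a b c : ℝ}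
    (h : Tendsto (fun x => c + a * Real.exp (2 * x) + b * Real.exp (-(2 * x))) atTop atTop) :
    0 < a := by
  by_contra! ha
  obtain ⟨x, hx, hx0⟩ := ((h.eventually_gt_atTop (c + |b|)).and (eventually_ge_atTop 0)).exists
  have h1 : a * Real.exp (2 * x) ≤ 0 := mul_nonpos_of_nonpos_of_nonneg ha (Real.exp_pos _).le
  have h2 : Real.exp (-(2 * x)) ≤ 1 := Real.exp_le_one_iff.2 (by linarith)
  have h3 : b * Real.exp (-(2 * x)) ≤ |b| :=
    (mul_le_mul_of_nonneg_right (le_abs_self b) (Real.exp_pos _).le).trans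
      (mul_le_of_le_one_right (abs_nonneg b) h2)
  linarith

/-- The first integral of the quintic equation, for solutions vanishing at infinity. -/
lemma quintic_first_integral {m : ℝ} {u v w : ℝ → ℝ}
    (huv : ∀ x, HasDerivAt u (v x) x) (hvw : ∀ x, HasDerivAt v (w x) x)
    (heq : ∀ x, -m * w x + m * u x - u x ^ 3 + u x ^ 5 = 0)
    (hm : 0 < m) (hlim : Tendsto u atTop (nhds 0)) (x : ℝ) :
    m * v x ^ 2 = m * u x ^ 2 - u x ^ 4 / 2 + u x ^ 6 / 3 := by
  set E : ℝ → ℝ := fun x => v x ^ 2 - (u x ^ 2 - u x ^ 4 / (2 * m) + u x ^ 6 / (3 * m)) with hE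
  have hd : ∀ y, HasDerivAt E 0 y := by
    intro y
    have h := ((hvw y).pow 2).sub
      ((((huv y).pow 2).sub (((huv y).pow 4).div_const (2 * m))).add
        (((huv y).pow 6).div_const (3 * m)))
    refine h.congr_deriv ?_
    field_simp
    simp only [Nat.cast_ofNat, Nat.add_one_sub_one]
    linear_combination (-12 * v y) * heq y
  have hc : ∀ y, E y = E x := fun y =>
    is_const_of_deriv_eq_zero (fun z => (hd z).differentiableAt) (fun z => (hd z).deriv) y x
  have hv : Tendsto (fun y => v y ^ 2) atTop (nhds (E x)) := by
    have : (fun y => v y ^ 2) =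
        fun y => E x + (u y ^ 2 - u y ^ 4 / (2 * m) + u y ^ 6 / (3 * m)) := by
      funext y; rw [← hc y]; simp [hE]
    rw [this]
    have h := tendsto_const_nhds (x := E x) (f := atTop (α := ℝ)) |>.add
      (((hlim.pow 2).sub ((hlim.pow 4).div_const (2 * m))).add ((hlim.pow 6).div_const (3 * m)))
    simpa using h
  have h0 := eq_zero_of_hasDerivAt_of_sq_tendsto huv hlim hv
  simp only [hE] at h0
  field_simp at h0
  linarith

/-- The inverse square of a nontrivial homoclinic solution is an explicit combination of
exponentials. -/
lemma quintic_homoclinic_inv_sq {m : ℝ} (hm : 0 < m) {u : ℝ → ℝ} (hu : ContDiff ℝ 2 u)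
    (hueq : ∀ x : ℝ, -m * iteratedDeriv 2 u x + m * u x - u x ^ 3 + u x ^ 5 = 0)
    (hunz : ∃ x : ℝ, u x ≠ 0) (hulim : Tendsto u (cocompact ℝ) (nhds 0)) :
    ∃ a b : ℝ, 0 < a ∧ 0 < b ∧ 4 * (a * b) = (1 / (4 * m)) ^ 2 - 1 / (3 * m) ∧
      ∀ x, (u x ^ 2)⁻¹ =
        1 / (4 * m) + a * Real.exp (2 * x) + b * Real.exp (-(2 * x)) := by
  have hd1 : ∀ x, HasDerivAt u (deriv u x) x := fun x =>
    (hu.differentiable (by norm_num) x).hasDerivAt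
  have hd2 : ∀ x, HasDerivAt (deriv u) (iteratedDeriv 2 u x) x := by
    intro x
    have h : ContDiff ℝ 1 (deriv u) := hu.deriv'
    rw [iteratedDeriv_succ, iteratedDeriv_one]
    exact (h.differentiable (by norm_num) x).hasDerivAt
  have htop : Tendsto u atTop (nhds 0) := hulim.mono_left atTop_le_cocompact
  have hbot : Tendsto u atBot (nhds 0) := hulim.mono_left atBot_le_cocompact
  have hint := quintic_first_integral hd1 hd2 hueq hm htop
  obtain ⟨M, hM⟩ : ∃ M, ∀ x, |u x| ≤ M := by
    let f : ZeroAtInftyContinuousMap ℝ ℝ := ⟨⟨u, hu.continuous⟩, hulim⟩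
    obtain ⟨M, hM⟩ := (ZeroAtInftyContinuousMap.isBounded_range f).exists_norm_le
    exact ⟨M, fun x => hM _ ⟨x, rfl⟩⟩
  have hpos : ∀ x, 0 < u x ^ 2 := by
    obtain ⟨x₀, hx₀⟩ := hunz
    intro x
    refine pos_of_abs_deriv_le (f := fun x => u x ^ 2) (f' := fun x => 2 * u x * deriv u x)
      (C := 2 + M ^ 4 / (3 * m)) (x₀ := x₀) (fun y => ?_) (fun y => ?_) (by positivity) x
    · exact ((hd1 y).pow 2).congr_deriv (by simp)
    · have h4 : u y ^ 4 ≤ M ^ 4 := by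
        have := pow_le_pow_left₀ (abs_nonneg (u y)) (hM y) 4
        rwa [show |u y| ^ 4 = u y ^ 4 from Even.pow_abs (by decide) _] at this
      have h5 : deriv u y ^ 2 ≤ u y ^ 2 * (1 + M ^ 4 / (3 * m)) := by
        have : m * deriv u y ^ 2 ≤ m * (u y ^ 2 * (1 + M ^ 4 / (3 * m))) := by
          rw [hint y]
          have e : m * (u y ^ 2 * (1 + M ^ 4 / (3 * m))) = m * u y ^ 2 + u y ^ 2 * M ^ 4 / 3 := by
            field_simp
          rw [e]
          nlinarith [mul_le_mul_of_nonneg_left h4 (sq_nonneg (u y)), sq_nonneg (u y ^ 2)]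
        exact le_of_mul_le_mul_left this hm
      rw [abs_le]
      constructor <;> nlinarith [sq_nonneg (u y + deriv u y), sq_nonneg (u y - deriv u y)]
  have hne : ∀ x, u x ≠ 0 := fun x h => by simpa [h] using hpos x
  have hq : ∀ x, HasDerivAt (fun y => (u y ^ 2)⁻¹ - 1 / (4 * m))
      (-2 * deriv u x / u x ^ 3) x := by
    intro x
    have h := (((hd1 x).pow 2).inv (pow_ne_zero 2 (hne x))).sub_const (1 / (4 * m))
    refine h.congr_deriv ?_
    have := hne x
    simp only [Pi.pow_apply, Nat.cast_ofNat, Nat.add_one_sub_one, pow_one]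
    field_simp
  have hq' : ∀ x, HasDerivAt (fun y => -2 * deriv u y / u y ^ 3)
      (4 * ((u x ^ 2)⁻¹ - 1 / (4 * m))) x := by
    intro x
    have h := ((hd2 x).const_mul (-2)).div ((hd1 x).pow 3) (pow_ne_zero 3 (hne x))
    refine h.congr_deriv ?_
    have := hne x
    have h1 := hueq x
    have h2 := hint x
    simp only [Pi.pow_apply, Nat.cast_ofNat, Nat.add_one_sub_one]
    field_simp
    linear_combination 2 * u x * h1 + 6 * h2
  obtain ⟨a, b, hab⟩ := exists_eq_exp_of_deriv_deriv_eq hq hq'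
  have hform : ∀ x, (u x ^ 2)⁻¹ =
      1 / (4 * m) + a * Real.exp (2 * x) + b * Real.exp (-(2 * x)) := fun x => by
    linear_combination (hab x).1
  have hinv : ∀ l : Filter ℝ, Tendsto u l (nhds 0) →
      Tendsto (fun x => (u x ^ 2)⁻¹) l atTop := by
    intro l hl
    refine Tendsto.inv_tendsto_nhdsGT_zero (tendsto_nhdsWithin_iff.2 ⟨?_, ?_⟩)
    · simpa using hl.pow 2
    · exact Eventually.of_forall hpos
  refine ⟨a, b, ?_, ?_, ?_, hform⟩
  · have h := hinv _ htop
    simp only [hform] at h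
    exact pos_of_tendsto_exp_atTop h
  · have h := (hinv _ hbot).comp tendsto_neg_atTop_atBot
    refine pos_of_tendsto_exp_atTop (b := a) (c := 1 / (4 * m)) (h.congr fun x => ?_)
    simp only [Function.comp, hform]
    rw [show 2 * -x = -(2 * x) by ring, neg_neg]
    ring
  · have h1 := (hab 0).1
    have h2 := (hab 0).2
    have h3 := hint 0
    have hn := hne 0
    simp only [mul_zero, neg_zero, Real.exp_zero, mul_one] at h1 h2
    have e : 4 * (a * b) = (a + b) ^ 2 - (2 * a - 2 * b) ^ 2 / 4 := by ring
    rw [e, ← h1, ← h2]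
    field_simp
    linear_combination (-48) * m * h3

/-- The derivative of the homoclinic profile. -/
lemma hasDerivAt_sqrt_div_one_add_mul_cosh {c k : ℝ} (hc : 0 < c) (hk : 0 ≤ k) (x : ℝ) :
    HasDerivAt (fun x => Real.sqrt (c / (1 + k * Real.cosh (2 * x))))
      (-(Real.sqrt (c / (1 + k * Real.cosh (2 * x))) *
        (k * Real.sinh (2 * x) / (1 + k * Real.cosh (2 * x))))) x := by
  have hD : 0 < 1 + k * Real.cosh (2 * x) := by
    have := Real.cosh_pos (2 * x)
    positivity
  have h1 : HasDerivAt (fun x => 1 + k * Real.cosh (2 * x)) (k * (Real.sinh (2 * x) * 2)) x := by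
    simpa using ((((hasDerivAt_id x).const_mul 2).cosh).const_mul k).const_add 1
  have h2 := ((hasDerivAt_const x c).div h1 hD.ne').sqrt (div_pos hc hD).ne'
  refine h2.congr_deriv ?_
  have hs : Real.sqrt (c / (1 + k * Real.cosh (2 * x))) ≠ 0 :=
    (Real.sqrt_pos.2 (div_pos hc hD)).ne'
  have hsq := Real.sq_sqrt (div_pos hc hD).le
  simp only [Pi.div_apply]
  generalize Real.sqrt (c / (1 + k * Real.cosh (2 * x))) = s at *
  generalize 1 + k * Real.cosh (2 * x) = D at *
  rw [eq_div_iff hD.ne'] at hsq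
  field_simp
  linear_combination k * Real.sinh (2 * x) * 2 * hsq

/-- The explicit profile solves the quintic equation. -/
lemma quintic_profile_eq {m ν : ℝ} (hν : ν ∈ Set.Ioo (0 : ℝ) 1) (hmν : m = 3 / 16 * (1 - ν))
    {r : ℝ → ℝ}
    (hr : r = fun x => Real.sqrt (3 / 4 * (1 - ν) / (1 + Real.sqrt ν * Real.cosh (2 * x))))
    (x : ℝ) : -m * iteratedDeriv 2 r x + m * r x - r x ^ 3 + r x ^ 5 = 0 := by
  have hc : 0 < 3 / 4 * (1 - ν) := by linarith [hν.2]
  have hk := Real.sqrt_nonneg ν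
  have hkν := Real.sq_sqrt hν.1.le
  have hd : ∀ x, HasDerivAt r
      (-(r x * (Real.sqrt ν * Real.sinh (2 * x) / (1 + Real.sqrt ν * Real.cosh (2 * x))))) x := by
    intro x
    rw [hr]
    exact hasDerivAt_sqrt_div_one_add_mul_cosh hc hk x
  have hD : 0 < 1 + Real.sqrt ν * Real.cosh (2 * x) := by
    have := Real.cosh_pos (2 * x)
    positivity
  have hcosh : HasDerivAt (fun x => 1 + Real.sqrt ν * Real.cosh (2 * x))
      (Real.sqrt ν * (Real.sinh (2 * x) * 2)) x := by
    simpa using ((((hasDerivAt_id x).const_mul 2).cosh).const_mul (Real.sqrt ν)).const_add 1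
  have hsinh : HasDerivAt (fun x => Real.sqrt ν * Real.sinh (2 * x))
      (Real.sqrt ν * (Real.cosh (2 * x) * 2)) x := by
    simpa using (((hasDerivAt_id x).const_mul 2).sinh).const_mul (Real.sqrt ν)
  have h2 := ((hd x).mul (hsinh.div hcosh hD.ne')).neg
  have hsq : r x ^ 2 * (1 + Real.sqrt ν * Real.cosh (2 * x)) = 4 * m := by
    rw [hr]
    simp only
    rw [Real.sq_sqrt (div_pos hc hD).le, div_mul_cancel₀ _ hD.ne', hmν]
    ring
  rw [iteratedDeriv_succ, iteratedDeriv_one, funext fun y => (hd y).deriv]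
  erw [h2.deriv]
  simp only [Pi.div_apply]
  have hcs := Real.cosh_sq (2 * x)
  generalize r x = s at *
  generalize Real.sinh (2 * x) = S at *
  generalize Real.cosh (2 * x) = T at *
  generalize Real.sqrt ν = k at *
  have hs2 : s ^ 2 = 4 * m / (1 + k * T) := by rw [eq_div_iff hD.ne', hsq]
  have e3 : s ^ 3 = s * (4 * m / (1 + k * T)) := by rw [← hs2]; ring
  have e5 : s ^ 5 = s * (4 * m / (1 + k * T)) ^ 2 := by rw [← hs2]; ring
  rw [e3, e5]
  field_simp
  subst hmν
  rw [← hkν]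
  linear_combination 9 / 16 * s * (k ^ 2 - k ^ 4) * hcs

/-- The explicit profile vanishes at infinity. -/
lemma tendsto_sqrt_div_one_add_mul_cosh {c k : ℝ} (hk : 0 < k) :
    Tendsto (fun x => Real.sqrt (c / (1 + k * Real.cosh (2 * x)))) (cocompact ℝ) (nhds 0) := by
  have hcosh : Tendsto (fun x => 1 + k * Real.cosh (2 * x)) (cocompact ℝ) atTop := by
    have hnorm : Tendsto (fun x : ℝ => |x|) (cocompact ℝ) atTop := tendsto_norm_cocompact_atTop
    refine tendsto_atTop_mono (fun x => ?_) (hnorm.const_mul_atTop hk)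
    have h1 : |x| ≤ Real.cosh (2 * x) := by
      rw [← Real.cosh_abs, Real.cosh_eq, abs_mul, abs_two]
      have h2 := Real.add_one_le_exp (2 * |x|)
      have h3 := Real.exp_pos (-(2 * |x|))
      linarith
    nlinarith
  have h := (Real.continuous_sqrt.tendsto 0).comp (hcosh.const_div_atTop c)
  simpa [Function.comp_def] using h

/-- A positive combination of `exp (2 x)` and `exp (-2 x)` is a translated hyperbolic cosine. -/
lemma exists_eq_mul_cosh_sub {a b k : ℝ} (ha : 0 < a) (hk : 0 < k) (hab : 4 * (a * b) = k ^ 2) :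
    ∃ x₀ : ℝ, ∀ x, a * Real.exp (2 * x) + b * Real.exp (-(2 * x)) =
      k * Real.cosh (2 * (x - x₀)) := by
  refine ⟨Real.log (k / (2 * a)) / 2, fun x => ?_⟩
  have hka : 0 < k / (2 * a) := by positivity
  rw [Real.cosh_eq, show 2 * (x - Real.log (k / (2 * a)) / 2) = 2 * x - Real.log (k / (2 * a)) by
    ring, neg_sub, Real.exp_sub, Real.exp_sub, Real.exp_log hka, Real.exp_neg]
  have := Real.exp_pos (2 * x)
  field_simp
  linear_combination hab

/-- If `−m u'' + m u − u³ + u⁵ = 0` (with `m > 0`) has a nontrivial real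
solution vanishing at infinity, then `m < 3/16`; writing `m = (3/16)(1−ν)`, the explicit
function `r(x) = √((3/4)(1−ν)/(1+√ν cosh 2x))` is a positive even solution vanishing at
infinity, and every positive solution vanishing at infinity is a translate of it. -/
theorem m_lt_three_sixteenth_and_unique_homoclinic (m : ℝ) (hm : 0 < m)
    (u : ℝ → ℝ) (hu : ContDiff ℝ 2 u)
    (hueq : ∀ x : ℝ, -m * iteratedDeriv 2 u x + m * u x - u x ^ 3 + u x ^ 5 = 0)
    (hunz : ∃ x : ℝ, u x ≠ 0)
    (hulim : Tendsto u (cocompact ℝ) (nhds 0)) :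
    m < 3 / 16 ∧
    ∀ ν : ℝ, ν ∈ Set.Ioo (0 : ℝ) 1 → m = 3 / 16 * (1 - ν) →
      let r : ℝ → ℝ := fun x =>
        Real.sqrt (3 / 4 * (1 - ν) / (1 + Real.sqrt ν * Real.cosh (2 * x)))
      (∀ x : ℝ, 0 < r x) ∧ (∀ x : ℝ, r (-x) = r x) ∧
      (∀ x : ℝ, -m * iteratedDeriv 2 r x + m * r x - r x ^ 3 + r x ^ 5 = 0) ∧
      Tendsto r (cocompact ℝ) (nhds 0) ∧
      (∀ w : ℝ → ℝ, ContDiff ℝ 2 w → (∀ x : ℝ, 0 < w x) →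
        (∀ x : ℝ, -m * iteratedDeriv 2 w x + m * w x - w x ^ 3 + w x ^ 5 = 0) →
        Tendsto w (cocompact ℝ) (nhds 0) →
        ∃ x₀ : ℝ, ∀ x : ℝ, w x = r (x - x₀)) := by
  obtain ⟨a, b, ha, hb, hab, -⟩ := quintic_homoclinic_inv_sq hm hu hueq hunz hulim
  refine ⟨?_, fun ν hν hmν => ?_⟩
  · have h : 0 < (1 / (4 * m)) ^ 2 - 1 / (3 * m) := by rw [← hab]; positivity
    have e : (1 / (4 * m)) ^ 2 - 1 / (3 * m) = (3 - 16 * m) / (48 * m ^ 2) := by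
      field_simp
      ring
    rw [e, div_pos_iff_of_pos_right (by positivity)] at h
    linarith
  intro r
  have hc : 0 < 3 / 4 * (1 - ν) := by linarith [hν.2]
  have hk : 0 < Real.sqrt ν := Real.sqrt_pos.2 hν.1
  have hD : ∀ x, 0 < 1 + Real.sqrt ν * Real.cosh (2 * x) := fun x => by
    have := Real.cosh_pos (2 * x)
    positivity
  refine ⟨fun x => Real.sqrt_pos.2 (div_pos hc (hD x)), fun x => ?_, quintic_profile_eq hν hmν rfl,
    tendsto_sqrt_div_one_add_mul_cosh hk, fun w hw hwpos hweq hwlim => ?_⟩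
  · simp only [r, mul_neg, Real.cosh_neg]
  obtain ⟨a, b, ha, -, hab, hform⟩ :=
    quintic_homoclinic_inv_sq hm hw hweq ⟨0, (hwpos 0).ne'⟩ hwlim
  obtain ⟨x₀, hx₀⟩ := exists_eq_mul_cosh_sub (b := b) (k := Real.sqrt ν / (4 * m)) ha
    (by positivity) (by
      rw [hab, div_pow (Real.sqrt ν), Real.sq_sqrt hν.1.le]
      field_simp
      linarith)
  refine ⟨x₀, fun x => ?_⟩
  have h := hform x
  rw [add_assoc, hx₀] at h
  rw [← Real.sqrt_sq (hwpos x).le]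
  simp only [r]
  congr 1
  rw [← inv_inv (w x ^ 2), h, show 3 / 4 * (1 - ν) = 4 * m by rw [hmν]; ring]
  have := hD (x - x₀)
  field_simp
end

section
/- For all ν ∈ (0,1) and all x ∈ ℝ, one has |R(x+L, ν) − R̃(x)| ≤ ν e^{−2x}. Moreover there exists a constant C > 0, independent of ν and x, such that for all ν ∈ (0,1) and all x ∈ ℝ, |∂ₓR(x+L, ν) − R̃'(x)| ≤ C ν e^{−2x}. -/
open Filter

/-- `m = (3/16)(1−ν)`. -/
noncomputable def m (ν : ℝ) : ℝ := 3 / 16 * (1 - ν)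

/-- `L = (1/4) log(4/ν)`. -/
noncomputable def L (ν : ℝ) : ℝ := 1 / 4 * Real.log (4 / ν)

/-- `R(x,ν) = (3/4)(1−ν)/(1+√ν cosh 2x)`. -/
noncomputable def R (x ν : ℝ) : ℝ :=
  3 / 4 * (1 - ν) / (1 + Real.sqrt ν * Real.cosh (2 * x))

/-- `R̃(x) = (3/4)/(1+e^{2x})`. -/
noncomputable def Rt (x : ℝ) : ℝ := 3 / 4 / (1 + Real.exp (2 * x))

lemma sqrt_mul_exp_two_mul_L {ν : ℝ} (hν : 0 < ν) : Real.sqrt ν * Real.exp (2 * L ν) = 2 := by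
  have h : Real.exp (2 * L ν) = Real.sqrt (4 / ν) := by
    rw [Real.sqrt_eq_rpow, Real.rpow_def_of_pos (by positivity), L]
    ring_nf
  rw [h, ← Real.sqrt_mul hν.le, mul_div_cancel₀ _ hν.ne',
    show (4 : ℝ) = 2 ^ 2 by norm_num, Real.sqrt_sq (by norm_num)]

lemma sqrt_mul_exp_shift {ν : ℝ} (hν : 0 < ν) (x : ℝ) :
    Real.sqrt ν * Real.exp (2 * (x + L ν)) = 2 * Real.exp (2 * x) := by
  rw [mul_add, Real.exp_add]
  linear_combination Real.exp (2 * x) * sqrt_mul_exp_two_mul_L hν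

lemma sqrt_mul_exp_neg_shift {ν : ℝ} (hν : 0 < ν) (x : ℝ) :
    Real.sqrt ν * Real.exp (-(2 * (x + L ν))) = ν / (2 * Real.exp (2 * x)) := by
  have h := sqrt_mul_exp_shift hν x
  have hs := Real.mul_self_sqrt hν.le
  rw [Real.exp_neg, ← h, ← hs]
  have := Real.sqrt_pos.2 hν
  have := Real.exp_pos (2 * (x + L ν))
  field_simp
  simp [*]

lemma sqrt_mul_cosh_shift {ν : ℝ} (hν : 0 < ν) (x : ℝ) :
    Real.sqrt ν * Real.cosh (2 * (x + L ν)) =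
      Real.exp (2 * x) + ν / (4 * Real.exp (2 * x)) := by
  rw [Real.cosh_eq]
  linear_combination (sqrt_mul_exp_shift hν x + sqrt_mul_exp_neg_shift hν x) / 2

lemma sqrt_mul_sinh_shift {ν : ℝ} (hν : 0 < ν) (x : ℝ) :
    Real.sqrt ν * Real.sinh (2 * (x + L ν)) =
      Real.exp (2 * x) - ν / (4 * Real.exp (2 * x)) := by
  rw [Real.sinh_eq]
  linear_combination (sqrt_mul_exp_shift hν x - sqrt_mul_exp_neg_shift hν x) / 2

lemma hasDerivAt_R (ν x : ℝ) :
    HasDerivAt (fun y => R y ν)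
      (-(3 / 2 * (1 - ν) * (Real.sqrt ν * Real.sinh (2 * x))) /
        (1 + Real.sqrt ν * Real.cosh (2 * x)) ^ 2) x := by
  have hpos : 0 < 1 + Real.sqrt ν * Real.cosh (2 * x) := by
    have := Real.cosh_pos (2 * x)
    positivity
  have hd : HasDerivAt (fun y => 1 + Real.sqrt ν * Real.cosh (2 * y))
      (Real.sqrt ν * (Real.sinh (2 * x) * (2 * 1))) x :=
    ((((hasDerivAt_id x).const_mul 2).cosh).const_mul _).const_add _
  exact ((hasDerivAt_const x (3 / 4 * (1 - ν))).div hd hpos.ne').congr_deriv (by ring)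

lemma hasDerivAt_Rt (x : ℝ) :
    HasDerivAt Rt (-(3 / 2 * Real.exp (2 * x)) / (1 + Real.exp (2 * x)) ^ 2) x := by
  have hpos : 0 < 1 + Real.exp (2 * x) := by positivity
  have hd : HasDerivAt (fun y => 1 + Real.exp (2 * y)) (Real.exp (2 * x) * (2 * 1)) x :=
    (((hasDerivAt_id x).const_mul 2).exp).const_add _
  exact ((hasDerivAt_const x (3 / 4 : ℝ)).div hd hpos.ne').congr_deriv (by ring)

/-- The profile estimate in the variables `t = e^{2x}`, `s = ν e^{-2x} / 4`. -/
lemma abs_profile_sub_le {t s : ℝ} (ht : 0 < t) (hs : 0 < s) :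
    |3 / 4 * (1 - 4 * t * s) / (1 + (t + s)) - 3 / 4 / (1 + t)| ≤ 4 * s := by
  have h : 3 / 4 * (1 - 4 * t * s) / (1 + (t + s)) - 3 / 4 / (1 + t) =
      -(3 / 4 * s * (4 * t * (1 + t) + 1) / ((1 + (t + s)) * (1 + t))) := by
    field_simp
    ring
  rw [h, abs_neg, abs_of_pos (by positivity), div_le_iff₀ (by positivity)]
  have : 3 / 4 * (4 * t * (1 + t) + 1) ≤ 4 * ((1 + (t + s)) * (1 + t)) := by
    nlinarith [mul_pos ht hs]
  nlinarith [mul_le_mul_of_nonneg_left this hs.le]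

/-- The estimate for the derivatives in the variables `t = e^{2x}`, `s = ν e^{-2x} / 4`. -/
lemma abs_profile_deriv_sub_le {t s : ℝ} (ht : 0 < t) (hs : 0 < s) :
    |-(3 / 2 * (1 - 4 * t * s) * (t - s)) / (1 + (t + s)) ^ 2 - -(3 / 2 * t) / (1 + t) ^ 2| ≤
      12 * s := by
  have h : -(3 / 2 * (1 - 4 * t * s) * (t - s)) / (1 + (t + s)) ^ 2 - -(3 / 2 * t) / (1 + t) ^ 2 =
      3 / 2 * s * ((2 * t * (1 + t) + t * s + (1 + t) ^ 2 + 4 * t * (t - s) * (1 + t) ^ 2) /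
        ((1 + (t + s)) ^ 2 * (1 + t) ^ 2)) := by
    field_simp
    ring
  have hts := mul_pos ht hs
  have hA : 1 ≤ (1 + t) ^ 2 := by nlinarith
  have hB : (1 + t) ^ 2 + t * s ≤ (1 + (t + s)) ^ 2 := by nlinarith
  have hB' : t * (t + s) ≤ (1 + (t + s)) ^ 2 := by nlinarith
  have hAB : (1 + (t + s)) ^ 2 ≤ (1 + (t + s)) ^ 2 * (1 + t) ^ 2 :=
    le_mul_of_one_le_right (by positivity) hA
  have hAB' : t * (t + s) * (1 + t) ^ 2 ≤ (1 + (t + s)) ^ 2 * (1 + t) ^ 2 :=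
    mul_le_mul_of_nonneg_right hB' (by positivity)
  have hP : 0 < t * t * (1 + t) ^ 2 := by positivity
  have hQ : 0 < t * s * (1 + t) ^ 2 := by positivity
  have key : |(2 * t * (1 + t) + t * s + (1 + t) ^ 2 + 4 * t * (t - s) * (1 + t) ^ 2) /
      ((1 + (t + s)) ^ 2 * (1 + t) ^ 2)| ≤ 8 := by
    rw [abs_div, abs_of_pos (show 0 < (1 + (t + s)) ^ 2 * (1 + t) ^ 2 by positivity),
      div_le_iff₀ (by positivity), abs_le]
    have h2 : 2 * t * (1 + t) ≤ 2 * (1 + t) ^ 2 := by nlinarith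
    have h3 : 0 < 2 * t * (1 + t) := by positivity
    have h4 : 0 < (1 + t) ^ 2 := by positivity
    constructor <;> linarith
  rw [h, abs_mul, abs_of_pos (by positivity)]
  nlinarith [mul_le_mul_of_nonneg_left key hs.le]

/-- `|R(x+L,ν) − R̃(x)| ≤ ν e^{−2x}` for all `ν ∈ (0,1)` and `x ∈ ℝ`, and
`|∂ₓR(x+L,ν) − R̃'(x)| ≤ C ν e^{−2x}` for a constant `C` independent of `ν` and `x`. -/
theorem front_approximation :
    (∀ ν ∈ Set.Ioo (0 : ℝ) 1, ∀ x : ℝ,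
      |R (x + L ν) ν - Rt x| ≤ ν * Real.exp (-2 * x)) ∧
    ∃ C > 0, ∀ ν ∈ Set.Ioo (0 : ℝ) 1, ∀ x : ℝ,
      |deriv (fun y => R y ν) (x + L ν) - deriv Rt x| ≤ C * ν * Real.exp (-2 * x) := by
  have hexp : ∀ ν x : ℝ, ν * Real.exp (-2 * x) = 4 * (ν / (4 * Real.exp (2 * x))) := by
    intro ν x
    rw [neg_mul, Real.exp_neg]
    field_simp
  have hν : ∀ ν x : ℝ, 4 * Real.exp (2 * x) * (ν / (4 * Real.exp (2 * x))) = ν := by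
    intro ν x
    field_simp
  refine ⟨fun ν h x => ?_, 3, by norm_num, fun ν h x => ?_⟩
  · have hb := abs_profile_sub_le (Real.exp_pos (2 * x))
      (div_pos h.1 (by positivity : 0 < 4 * Real.exp (2 * x)))
    rw [hν] at hb
    rwa [hexp, R, Rt, sqrt_mul_cosh_shift h.1]
  · have hb := abs_profile_deriv_sub_le (Real.exp_pos (2 * x))
      (div_pos h.1 (by positivity : 0 < 4 * Real.exp (2 * x)))
    rw [hν] at hb
    rw [(hasDerivAt_R ν _).deriv, (hasDerivAt_Rt x).deriv, sqrt_mul_cosh_shift h.1,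
      sqrt_mul_sinh_shift h.1, mul_assoc 3 ν, hexp]
    linarith
end

section
/- There exist constants C > 0 and ν₀ ∈ (0,1) such that for all ν ∈ (0,ν₀): |∫_ℝ σ(x,ν)² dx − 3/8| ≤ C √ν, and |∫_ℝ (−m σ'' + V σ)·σ dx + 9ν/16| ≤ C ν^{3/2}. Consequently the Rayleigh quotient (∫_ℝ (−m σ'' + V σ)·σ dx)/(∫_ℝ σ² dx) equals −3ν/2 up to a relative error tending to 0 as ν → 0. -/
open MeasureTheory Filter

/-- `r(x,ν) = √R(x,ν)`, the positive even pulse. -/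
noncomputable def r (x ν : ℝ) : ℝ := Real.sqrt (R x ν)

/-- `V = m − 3r² + 5r⁴`, the linearized potential. -/
noncomputable def V (x ν : ℝ) : ℝ := m ν - 3 * r x ν ^ 2 + 5 * r x ν ^ 4

/-- `σ(x,ν) = −4ν ∂r/∂ν`. -/
noncomputable def sigma (x ν : ℝ) : ℝ := -4 * ν * deriv (fun t => r x t) ν

/-- `(Aσ, σ) = ∫ (−m σ'' + V σ) σ`. -/
noncomputable def Asigma_sigma (ν : ℝ) : ℝ :=
  ∫ x : ℝ, (-m ν * deriv (deriv (fun y => sigma y ν)) x + V x ν * sigma x ν) * sigma x ν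

/-- The denominator-inverse `w = 1/(1 + s cosh 2x)` governing the pulse, with `s = √ν`. -/
noncomputable def invDenom (s x : ℝ) : ℝ := (1 + s * Real.cosh (2 * x))⁻¹

/-- `g = s sinh(2x) w`, minus the logarithmic derivative of `√w`. -/
noncomputable def logSlope (s x : ℝ) : ℝ := s * Real.sinh (2 * x) * invDenom s x

section Profile

variable {s : ℝ}

lemma denom_pos (hs : 0 < s) (x : ℝ) : 0 < 1 + s * Real.cosh (2 * x) := by
  have := Real.cosh_pos (2 * x)
  positivity

lemma invDenom_pos (hs : 0 < s) (x : ℝ) : 0 < invDenom s x := inv_pos.2 (denom_pos hs x)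

lemma invDenom_le_one (hs : 0 < s) (x : ℝ) : invDenom s x ≤ 1 := by
  have := Real.cosh_pos (2 * x)
  exact inv_le_one_of_one_le₀ (by nlinarith)

lemma invDenom_neg (s x : ℝ) : invDenom s (-x) = invDenom s x := by
  simp [invDenom]

lemma logSlope_neg (s x : ℝ) : logSlope s (-x) = -logSlope s x := by
  simp [logSlope, invDenom_neg]

lemma cosh_two_mul_ge (x : ℝ) : 1 + x ^ 2 ≤ Real.cosh (2 * x) := by
  have h := Real.cosh_two_mul x
  have h2 := Real.cosh_sq x
  have h3 : x ^ 2 ≤ Real.sinh x ^ 2 := by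
    rw [sq_le_sq]
    rcases le_total 0 x with hx | hx
    · rw [abs_of_nonneg hx]
      exact (Real.self_le_sinh_iff.2 hx).trans (le_abs_self _)
    · rw [abs_of_nonpos hx]
      have := Real.sinh_le_self_iff.2 hx
      exact (by linarith : -x ≤ -Real.sinh x).trans (neg_le_abs _)
  nlinarith [sq_nonneg x]

lemma invDenom_le (hs : 0 < s) (x : ℝ) : invDenom s x ≤ s⁻¹ * (1 + x ^ 2)⁻¹ := by
  rw [← mul_inv]
  apply inv_anti₀ (by positivity)
  nlinarith [cosh_two_mul_ge x]

lemma continuous_invDenom (hs : 0 < s) : Continuous (invDenom s) := by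
  unfold invDenom
  refine Continuous.inv₀ (by fun_prop) fun x => (denom_pos hs x).ne'

lemma integrable_invDenom (hs : 0 < s) : Integrable (invDenom s) := by
  refine (integrable_inv_one_add_sq.const_mul s⁻¹).mono'
    (continuous_invDenom hs).aestronglyMeasurable (.of_forall fun x => ?_)
  rw [Real.norm_of_nonneg (invDenom_pos hs x).le]
  exact invDenom_le hs x

lemma integrable_invDenom_pow (hs : 0 < s) {n : ℕ} (hn : n ≠ 0) :
    Integrable fun x => invDenom s x ^ n := by
  refine (integrable_invDenom hs).mono'
    ((continuous_invDenom hs).pow n).aestronglyMeasurable (.of_forall fun x => ?_)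
  rw [Real.norm_of_nonneg (pow_nonneg (invDenom_pos hs x).le n)]
  exact pow_le_of_le_one (invDenom_pos hs x).le (invDenom_le_one hs x) hn

lemma integral_invDenom_nonneg (hs : 0 < s) : 0 ≤ ∫ x, invDenom s x :=
  integral_nonneg fun x => (invDenom_pos hs x).le

lemma integral_invDenom_le (hs : 0 < s) : ∫ x, invDenom s x ≤ 4 / s := by
  have h := integral_mono (integrable_invDenom hs)
    (integrable_inv_one_add_sq.const_mul s⁻¹) (invDenom_le hs)
  rw [integral_const_mul, integral_univ_inv_one_add_sq] at h
  refine h.trans ?_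
  rw [div_eq_inv_mul]
  exact mul_le_mul_of_nonneg_left Real.pi_le_four (by positivity)

lemma logSlope_sq (hs : 0 < s) (x : ℝ) :
    logSlope s x ^ 2 = 1 - 2 * invDenom s x + (1 - s ^ 2) * invDenom s x ^ 2 := by
  have h := Real.cosh_sq (2 * x)
  have hD := (denom_pos hs x).ne'
  unfold logSlope invDenom
  field_simp
  linear_combination (-s ^ 2) * h

lemma hasDerivAt_cosh_two_mul (x : ℝ) :
    HasDerivAt (fun y => Real.cosh (2 * y)) (2 * Real.sinh (2 * x)) x := by
  have := ((hasDerivAt_id x).const_mul 2).cosh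
  simpa [mul_comm] using this

lemma hasDerivAt_sinh_two_mul (x : ℝ) :
    HasDerivAt (fun y => Real.sinh (2 * y)) (2 * Real.cosh (2 * x)) x := by
  have := ((hasDerivAt_id x).const_mul 2).sinh
  simpa [mul_comm] using this

lemma hasDerivAt_invDenom (hs : 0 < s) (x : ℝ) :
    HasDerivAt (invDenom s) (-2 * invDenom s x * logSlope s x) x := by
  have hD := (denom_pos hs x).ne'
  refine ((((hasDerivAt_cosh_two_mul x).const_mul s).const_add 1).inv hD).congr_deriv ?_
  unfold logSlope invDenom
  field_simp

lemma hasDerivAt_logSlope (hs : 0 < s) (x : ℝ) :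
    HasDerivAt (logSlope s)
      (2 * invDenom s x - 2 * (1 - s ^ 2) * invDenom s x ^ 2) x := by
  have hD := (denom_pos hs x).ne'
  refine (((hasDerivAt_sinh_two_mul x).const_mul s).mul
    (hasDerivAt_invDenom hs x)).congr_deriv ?_
  have h := Real.cosh_sq (2 * x)
  unfold logSlope invDenom
  field_simp
  linear_combination s ^ 2 * h

lemma tendsto_invDenom_atTop (hs : 0 < s) : Tendsto (invDenom s) atTop (nhds 0) := by
  refine tendsto_inv_atTop_zero.comp (tendsto_atTop_mono (fun x => ?_)
    (tendsto_id.const_mul_atTop hs))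
  simp only [id]
  nlinarith [cosh_two_mul_ge x, sq_nonneg (x - 1)]

lemma tendsto_logSlope_atTop (hs : 0 < s) : Tendsto (logSlope s) atTop (nhds 1) := by
  have hE : Tendsto (fun x : ℝ => Real.exp (-(2 * x))) atTop (nhds 0) :=
    Real.tendsto_exp_neg_atTop_nhds_zero.comp (tendsto_id.const_mul_atTop two_pos)
  have h := ((hE.const_mul s).const_add 1).mul (tendsto_invDenom_atTop hs)
  have h' := h.const_sub 1
  simp only [mul_zero, sub_zero] at h'
  refine h'.congr fun x => ?_
  have hD := (denom_pos hs x).ne'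
  rw [← Real.cosh_sub_sinh]
  unfold logSlope invDenom
  field_simp
  ring

lemma tendsto_invDenom_atBot (hs : 0 < s) : Tendsto (invDenom s) atBot (nhds 0) :=
  ((tendsto_invDenom_atTop hs).comp tendsto_neg_atBot_atTop).congr fun x => invDenom_neg s x

lemma tendsto_logSlope_atBot (hs : 0 < s) : Tendsto (logSlope s) atBot (nhds (-1)) :=
  ((tendsto_logSlope_atTop hs).comp tendsto_neg_atBot_atTop).neg.congr fun x => by
    simp [logSlope_neg]

lemma integral_invDenom_sq (hs : 0 < s) :
    (1 - s ^ 2) * ∫ x, invDenom s x ^ 2 = (∫ x, invDenom s x) - 1 := by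
  have i1 := (integrable_invDenom hs).const_mul 2
  have i2 := (integrable_invDenom_pow hs two_ne_zero).const_mul (2 * (1 - s ^ 2))
  have h := integral_of_hasDerivAt_of_tendsto (hasDerivAt_logSlope hs) (i1.sub i2)
    (tendsto_logSlope_atBot hs) (tendsto_logSlope_atTop hs)
  rw [integral_sub i1 i2, integral_const_mul, integral_const_mul] at h
  linarith

lemma integral_invDenom_cube (hs : 0 < s) :
    2 * (1 - s ^ 2) * ∫ x, invDenom s x ^ 3 =
      3 * (∫ x, invDenom s x ^ 2) - ∫ x, invDenom s x := by
  have i1 := integrable_invDenom hs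
  have i2 := (integrable_invDenom_pow hs two_ne_zero).const_mul 3
  have i3 := (integrable_invDenom_pow hs three_ne_zero).const_mul (2 * (1 - s ^ 2))
  have i12 : Integrable fun x => invDenom s x - 3 * invDenom s x ^ 2 := i1.sub i2
  have hd : ∀ x, HasDerivAt (fun y => -(1 / 2) * (invDenom s y * logSlope s y))
      (invDenom s x - 3 * invDenom s x ^ 2 + 2 * (1 - s ^ 2) * invDenom s x ^ 3) x := by
    intro x
    refine (((hasDerivAt_invDenom hs x).mul (hasDerivAt_logSlope hs x)).const_mul
      _).congr_deriv ?_
    linear_combination invDenom s x * logSlope_sq hs x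
  have h := integral_of_hasDerivAt_of_tendsto hd (i12.add i3)
    (((tendsto_invDenom_atBot hs).mul (tendsto_logSlope_atBot hs)).const_mul _)
    (((tendsto_invDenom_atTop hs).mul (tendsto_logSlope_atTop hs)).const_mul _)
  rw [integral_add i12 i3, integral_sub i1 i2, integral_const_mul,
    integral_const_mul] at h
  linarith

lemma integral_invDenom_fourth (hs : 0 < s) :
    3 * (1 - s ^ 2) * ∫ x, invDenom s x ^ 4 =
      5 * (∫ x, invDenom s x ^ 3) - 2 * ∫ x, invDenom s x ^ 2 := by
  have i2 := (integrable_invDenom_pow hs two_ne_zero).const_mul 2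
  have i3 := (integrable_invDenom_pow hs three_ne_zero).const_mul 5
  have i4 := (integrable_invDenom_pow hs four_ne_zero).const_mul (3 * (1 - s ^ 2))
  have i23 : Integrable fun x => 2 * invDenom s x ^ 2 - 5 * invDenom s x ^ 3 := i2.sub i3
  have hd : ∀ x, HasDerivAt (fun y => -(1 / 2) * (invDenom s y ^ 2 * logSlope s y))
      (2 * invDenom s x ^ 2 - 5 * invDenom s x ^ 3 + 3 * (1 - s ^ 2) * invDenom s x ^ 4) x := by
    intro x
    refine ((((hasDerivAt_invDenom hs x).pow 2).mul (hasDerivAt_logSlope hs x)).const_mul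
      _).congr_deriv ?_
    simp only [Pi.pow_apply]
    push_cast
    linear_combination 2 * invDenom s x ^ 2 * logSlope_sq hs x
  have h := integral_of_hasDerivAt_of_tendsto hd (i23.add i4)
    ((((tendsto_invDenom_atBot hs).pow 2).mul (tendsto_logSlope_atBot hs)).const_mul _)
    ((((tendsto_invDenom_atTop hs).pow 2).mul (tendsto_logSlope_atTop hs)).const_mul _)
  rw [integral_add i23 i4, integral_sub i2 i3, integral_const_mul,
    integral_const_mul, integral_const_mul] at h
  linarith

end Profile

section Pulse

variable {ν : ℝ}

lemma R_eq_mul_invDenom (x ν : ℝ) : R x ν = 3 / 4 * (1 - ν) * invDenom √ν x :=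
  div_eq_mul_inv _ _

lemma R_pos (h0 : 0 < ν) (h1 : ν < 1) (x : ℝ) : 0 < R x ν := by
  have := invDenom_pos (Real.sqrt_pos.2 h0) x
  have : 0 < 1 - ν := by linarith
  rw [R_eq_mul_invDenom]
  positivity

lemma r_sq (h0 : 0 < ν) (h1 : ν < 1) (x : ℝ) :
    r x ν ^ 2 = 3 / 4 * (1 - ν) * invDenom √ν x := by
  rw [r, Real.sq_sqrt (R_pos h0 h1 x).le, R_eq_mul_invDenom]

lemma sigma_eq (h0 : 0 < ν) (h1 : ν < 1) (x : ℝ) :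
    sigma x ν = r x ν * ((1 + ν) / (1 - ν) - invDenom √ν x) := by
  have hs := Real.sqrt_pos.2 h0
  have hD := (denom_pos hs x).ne'
  have hν : 1 - ν ≠ 0 := by linarith
  have hR := R_pos h0 h1 x
  have hnum : HasDerivAt (fun t : ℝ => 3 / 4 * (1 - t)) (3 / 4 * -1) ν :=
    ((hasDerivAt_id ν).const_sub 1).const_mul _
  have hden : HasDerivAt (fun t : ℝ => 1 + √t * Real.cosh (2 * x))
      (1 / (2 * √ν) * Real.cosh (2 * x)) ν :=
    ((Real.hasDerivAt_sqrt h0.ne').mul_const _).const_add 1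
  have hr : HasDerivAt (fun t => r x t) _ ν := (hnum.div hden hD).sqrt hR.ne'
  rw [sigma, hr.deriv]
  change -4 * ν * (_ / (2 * r x ν)) = _
  have hrpos : r x ν ≠ 0 := (Real.sqrt_pos.2 hR).ne'
  have hr2 := r_sq h0 h1 x
  have hsq := Real.sq_sqrt h0.le
  rw [mul_div_assoc', div_eq_iff (by positivity)]
  have : r x ν * ((1 + ν) / (1 - ν) - invDenom √ν x) * (2 * r x ν)
      = 2 * (3 / 4 * (1 - ν) * invDenom √ν x) * ((1 + ν) / (1 - ν) - invDenom √ν x) := by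
    rw [← hr2]; ring
  rw [this]
  unfold invDenom
  generalize √ν = s at *
  subst hsq
  field_simp
  ring

lemma hasDerivAt_r (h0 : 0 < ν) (h1 : ν < 1) (x : ℝ) :
    HasDerivAt (fun y => r y ν) (-(r x ν * logSlope √ν x)) x := by
  have hs := Real.sqrt_pos.2 h0
  have hR := R_pos h0 h1 x
  have hrpos : r x ν ≠ 0 := (Real.sqrt_pos.2 hR).ne'
  have hd : HasDerivAt (fun y => R y ν)
      (3 / 4 * (1 - ν) * (-2 * invDenom √ν x * logSlope √ν x)) x := by
    simp only [R_eq_mul_invDenom]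
    exact (hasDerivAt_invDenom hs x).const_mul _
  refine (hd.sqrt hR.ne').congr_deriv ?_
  change _ / (2 * r x ν) = _
  rw [div_eq_iff (by positivity)]
  linear_combination 2 * logSlope √ν x * r_sq h0 h1 x

lemma deriv_deriv_sigma (h0 : 0 < ν) (h1 : ν < 1) (x : ℝ) :
    deriv (deriv fun y => sigma y ν) x = r x ν *
      ((1 - 2 * invDenom √ν x + (1 - ν) * invDenom √ν x ^ 2) *
          ((1 + ν) / (1 - ν) - 9 * invDenom √ν x) +
        (2 * invDenom √ν x - 2 * (1 - ν) * invDenom √ν x ^ 2) *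
          (3 * invDenom √ν x - (1 + ν) / (1 - ν))) := by
  have hs := Real.sqrt_pos.2 h0
  have hsq := Real.sq_sqrt h0.le
  have e1 : (deriv fun y => sigma y ν) = fun y =>
      r y ν * (logSlope √ν y * (3 * invDenom √ν y - (1 + ν) / (1 - ν))) := by
    simp only [sigma_eq h0 h1]
    funext y
    refine HasDerivAt.deriv (((hasDerivAt_r h0 h1 y).mul
      ((hasDerivAt_invDenom hs y).const_sub _)).congr_deriv ?_)
    ring
  rw [e1]
  refine HasDerivAt.deriv (((hasDerivAt_r h0 h1 x).mul ((hasDerivAt_logSlope hs x).mul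
    (((hasDerivAt_invDenom hs x).const_mul 3).sub_const _))).congr_deriv ?_)
  have hg := logSlope_sq hs x
  rw [hsq] at hg ⊢
  simp only [Pi.mul_apply]
  linear_combination r x ν * ((1 + ν) / (1 - ν) - 9 * invDenom √ν x) * hg

lemma integral_sigma_sq (h0 : 0 < ν) (h1 : ν < 1) :
    ∫ x, sigma x ν ^ 2 =
      3 / (4 * (1 - ν)) * ((ν ^ 2 + ν / 2) * (∫ x, invDenom √ν x) + 1 / 2 + 2 * ν) := by
  have hs := Real.sqrt_pos.2 h0
  have hν : 1 - ν ≠ 0 := by linarith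
  set a := (1 + ν) / (1 - ν) with ha
  set k := 3 / 4 * (1 - ν) with hk
  have e : (fun x => sigma x ν ^ 2) = fun x => k * a ^ 2 * invDenom √ν x -
      2 * k * a * invDenom √ν x ^ 2 + k * invDenom √ν x ^ 3 := by
    funext x
    rw [sigma_eq h0 h1, mul_pow, r_sq h0 h1]
    ring
  have i1 := (integrable_invDenom hs).const_mul (k * a ^ 2)
  have i2 := (integrable_invDenom_pow hs two_ne_zero).const_mul (2 * k * a)
  have i3 := (integrable_invDenom_pow hs three_ne_zero).const_mul k
  have i12 : Integrable fun x =>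
      k * a ^ 2 * invDenom √ν x - 2 * k * a * invDenom √ν x ^ 2 := i1.sub i2
  rw [e, integral_add i12 i3, integral_sub i1 i2, integral_const_mul,
    integral_const_mul, integral_const_mul]
  have r2 := integral_invDenom_sq hs
  have r3 := integral_invDenom_cube hs
  rw [Real.sq_sqrt h0.le] at r2 r3
  rw [ha, hk]
  generalize ∫ x, invDenom √ν x = I₁ at *
  generalize ∫ x, invDenom √ν x ^ 2 = I₂ at *
  generalize ∫ x, invDenom √ν x ^ 3 = I₃ at *
  have r2' : I₂ = (I₁ - 1) / (1 - ν) := by field_simp; linarith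
  have r3' : I₃ = (3 * I₂ - I₁) / (2 * (1 - ν)) := by field_simp; linarith
  rw [r3', r2']
  field_simp
  ring

lemma Asigma_sigma_eq (h0 : 0 < ν) (h1 : ν < 1) :
    Asigma_sigma ν = 9 * ν / (4 * (1 - ν)) *
      (-(1 / 4) + 3 * ν / 8 - ν * (1 / 2 - 3 * ν / 8) * ∫ x, invDenom √ν x) := by
  have hs := Real.sqrt_pos.2 h0
  have hν : 1 - ν ≠ 0 := by linarith
  have e : (fun x => (-m ν * deriv (deriv (fun y => sigma y ν)) x + V x ν * sigma x ν)
      * sigma x ν) = fun x => 9 * ν / 4 * (1 - ν) * (1 + 3 / 4 * (1 + ν)) * invDenom √ν x ^ 3 -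
      9 * ν / 4 * (1 + ν) * invDenom √ν x ^ 2 -
      27 * ν / 16 * (1 - ν) ^ 2 * invDenom √ν x ^ 4 := by
    funext x
    have h4 : r x ν ^ 4 = (3 / 4 * (1 - ν) * invDenom √ν x) ^ 2 := by
      rw [← r_sq h0 h1]; ring
    rw [deriv_deriv_sigma h0 h1, sigma_eq h0 h1, V, h4, m, r_sq h0 h1]
    have h2 := r_sq h0 h1 x
    generalize r x ν = ρ at *
    generalize invDenom √ν x = w at *
    have : ∀ A B v a : ℝ, (A * (ρ * B) + v * (ρ * a)) * (ρ * a) = ρ ^ 2 * (A * B + v * a) * a := by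
      intros; ring
    rw [this, h2]
    field_simp
    ring
  have i2 := (integrable_invDenom_pow hs two_ne_zero).const_mul (9 * ν / 4 * (1 + ν))
  have i3 := (integrable_invDenom_pow hs three_ne_zero).const_mul
    (9 * ν / 4 * (1 - ν) * (1 + 3 / 4 * (1 + ν)))
  have i4 := (integrable_invDenom_pow hs four_ne_zero).const_mul (27 * ν / 16 * (1 - ν) ^ 2)
  have i32 : Integrable fun x =>
      9 * ν / 4 * (1 - ν) * (1 + 3 / 4 * (1 + ν)) * invDenom √ν x ^ 3 -
        9 * ν / 4 * (1 + ν) * invDenom √ν x ^ 2 := i3.sub i2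
  rw [Asigma_sigma, e, integral_sub i32 i4, integral_sub i3 i2, integral_const_mul,
    integral_const_mul, integral_const_mul]
  have r2 := integral_invDenom_sq hs
  have r3 := integral_invDenom_cube hs
  have r4 := integral_invDenom_fourth hs
  rw [Real.sq_sqrt h0.le] at r2 r3 r4
  generalize ∫ x, invDenom √ν x = I₁ at *
  generalize ∫ x, invDenom √ν x ^ 2 = I₂ at *
  generalize ∫ x, invDenom √ν x ^ 3 = I₃ at *
  generalize ∫ x, invDenom √ν x ^ 4 = I₄ at *
  have r2' : I₂ = (I₁ - 1) / (1 - ν) := by field_simp; linarith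
  have r3' : I₃ = (3 * I₂ - I₁) / (2 * (1 - ν)) := by field_simp; linarith
  have r4' : I₄ = (5 * I₃ - 2 * I₂) / (3 * (1 - ν)) := by field_simp; linarith
  rw [r4', r3', r2']
  field_simp
  ring

lemma abs_integral_sigma_sq_sub_le (h0 : 0 < ν) (h1 : ν < 1 / 2) :
    |(∫ x, sigma x ν ^ 2) - 3 / 8| ≤ 10 * √ν := by
  have hs := Real.sqrt_pos.2 h0
  have hI0 := integral_invDenom_nonneg hs
  have hI := integral_invDenom_le hs
  have hsq := Real.sq_sqrt h0.le
  have hκ : 0 < 1 - ν := by linarith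
  rw [integral_sigma_sq h0 (by linarith)]
  generalize ∫ x, invDenom √ν x = I at *
  generalize √ν = s at *
  rw [le_div_iff₀ hs] at hI
  have hs1 : s ≤ 1 := by nlinarith
  have e : 3 / (4 * (1 - ν)) * ((ν ^ 2 + ν / 2) * I + 1 / 2 + 2 * ν) - 3 / 8 =
      3 * ((ν ^ 2 + ν / 2) * I + 5 * ν / 2) / (4 * (1 - ν)) := by
    field_simp
    ring
  rw [e, abs_of_nonneg (by positivity), div_le_iff₀ (by positivity)]
  have hνI : ν * I ≤ 4 * s := by rw [← hsq]; nlinarith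
  have hνs : ν ≤ s := by nlinarith
  have hν2 : ν ^ 2 * I ≤ ν * I / 2 := by nlinarith [mul_nonneg h0.le hI0]
  nlinarith

lemma abs_Asigma_sigma_add_le (h0 : 0 < ν) (h1 : ν < 1 / 2) :
    |Asigma_sigma ν + 9 * ν / 16| ≤ 10 * (ν * √ν) := by
  have hs := Real.sqrt_pos.2 h0
  have hI0 := integral_invDenom_nonneg hs
  have hI := integral_invDenom_le hs
  have hsq := Real.sq_sqrt h0.le
  have hκ : 0 < 1 - ν := by linarith
  rw [Asigma_sigma_eq h0 (by linarith)]
  generalize ∫ x, invDenom √ν x = I at *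
  generalize √ν = s at *
  rw [le_div_iff₀ hs] at hI
  have hs1 : s ≤ 1 := by nlinarith
  have e : 9 * ν / (4 * (1 - ν)) * (-(1 / 4) + 3 * ν / 8 - ν * (1 / 2 - 3 * ν / 8) * I)
      + 9 * ν / 16 = ν * (9 * (ν / 8 - (1 / 2 - 3 * ν / 8) * (ν * I)) / (4 * (1 - ν))) := by
    field_simp
    ring
  have hνI : ν * I ≤ 4 * s := by rw [← hsq]; nlinarith
  have hνI0 : 0 ≤ ν * I := by positivity
  have hνs : ν ≤ s := by nlinarith
  rw [e, abs_mul, abs_of_pos h0, mul_left_comm 10 ν s]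
  refine mul_le_mul_of_nonneg_left ?_ h0.le
  rw [abs_div, abs_of_pos (show 0 < 4 * (1 - ν) by positivity), div_le_iff₀ (by positivity),
    abs_le]
  constructor <;> nlinarith

end Pulse

/-- `|∫σ² − 3/8| ≤ C√ν` and `|(Aσ,σ) + 9ν/16| ≤ Cν^{3/2}` for small `ν`;
consequently the Rayleigh quotient `(Aσ,σ)/(σ,σ)` equals `−3ν/2` up to a relative error
tending to `0` as `ν → 0⁺`. -/
theorem sigma_rayleigh_quotient :
    (∃ C > 0, ∃ ν₀ ∈ Set.Ioo (0 : ℝ) 1, ∀ ν ∈ Set.Ioo (0 : ℝ) ν₀,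
      |(∫ x : ℝ, sigma x ν ^ 2) - 3 / 8| ≤ C * Real.sqrt ν ∧
      |Asigma_sigma ν + 9 * ν / 16| ≤ C * ν ^ ((3 : ℝ) / 2)) ∧
    Tendsto (fun ν => (Asigma_sigma ν / (∫ x : ℝ, sigma x ν ^ 2)) / (-(3 * ν / 2)))
      (nhdsWithin 0 (Set.Ioi 0)) (nhds 1) := by
  have hbound : ∀ ν ∈ Set.Ioo (0 : ℝ) (1 / 2),
      |(∫ x : ℝ, sigma x ν ^ 2) - 3 / 8| ≤ 10 * Real.sqrt ν ∧
      |Asigma_sigma ν + 9 * ν / 16| ≤ 10 * (ν * Real.sqrt ν) := fun ν hν =>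
    ⟨abs_integral_sigma_sq_sub_le hν.1 hν.2, abs_Asigma_sigma_add_le hν.1 hν.2⟩
  constructor
  · refine ⟨10, by norm_num, 1 / 2, by norm_num, fun ν hν => ?_⟩
    have hpow : ν ^ ((3 : ℝ) / 2) = ν * Real.sqrt ν := by
      rw [Real.sqrt_eq_rpow, ← Real.rpow_one_add' hν.1.le (by norm_num)]
      norm_num
    rw [hpow]
    exact hbound ν hν
  · have hmem : Set.Ioo (0 : ℝ) (1 / 2) ∈ nhdsWithin 0 (Set.Ioi 0) :=
      Ioo_mem_nhdsGT (by norm_num)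
    have hsqrt : Tendsto (fun ν : ℝ => 10 * Real.sqrt ν) (nhdsWithin 0 (Set.Ioi 0)) (nhds 0) := by
      have : Tendsto (fun ν : ℝ => 10 * Real.sqrt ν) (nhds 0) (nhds (10 * Real.sqrt 0)) :=
        (Real.continuous_sqrt.const_mul 10).tendsto 0
      rw [Real.sqrt_zero, mul_zero] at this
      exact this.mono_left nhdsWithin_le_nhds
    have hQ : Tendsto (fun ν => ∫ x : ℝ, sigma x ν ^ 2) (nhdsWithin 0 (Set.Ioi 0))
        (nhds (3 / 8)) := by
      rw [tendsto_iff_norm_sub_tendsto_zero]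
      refine squeeze_zero' (.of_forall fun _ => norm_nonneg _) ?_ hsqrt
      filter_upwards [hmem] with ν hν using (hbound ν hν).1
    have hA : Tendsto (fun ν => Asigma_sigma ν / ν) (nhdsWithin 0 (Set.Ioi 0))
        (nhds (-(9 / 16))) := by
      rw [tendsto_iff_norm_sub_tendsto_zero]
      refine squeeze_zero' (.of_forall fun _ => norm_nonneg _) ?_ hsqrt
      filter_upwards [hmem] with ν hν
      have h0 := hν.1
      have e : Asigma_sigma ν / ν - -(9 / 16) = (Asigma_sigma ν + 9 * ν / 16) / ν := by
        field_simp
        ring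
      rw [e, Real.norm_eq_abs, abs_div, abs_of_pos h0, div_le_iff₀ h0]
      linarith [(hbound ν hν).2]
    have h := (hA.div hQ (by norm_num)).div_const (-(3 / 2))
    norm_num at h
    refine h.congr fun ν => ?_
    simp only [div_eq_mul_inv, mul_inv, inv_neg]
    ring
end

section
/- There exist constants C > 0 and ν₀ ∈ (0,1) such that for all ν ∈ (0,ν₀): |θ(ν) − 3/4 + 3/(8L)| ≤ C √ν; moreover the function L ↦ θ(4e^{−4L}) is differentiable and its derivative θ₁ satisfies |θ₁ − 3/(8L²)| ≤ C √ν / L. -/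
open MeasureTheory Filter

/-- `θ(ν) = (∫ r⁴)/(∫ r²)`. -/
noncomputable def theta (ν : ℝ) : ℝ := (∫ x : ℝ, r x ν ^ 4) / (∫ x : ℝ, r x ν ^ 2)

open Topology

/-- A continuous nonnegative derivative of a function with finite limits at both ends of the line
is integrable. -/
lemma integrable_of_hasDerivAt_of_nonneg_of_tendsto {F f : ℝ → ℝ} {m n : ℝ}
    (hderiv : ∀ x, HasDerivAt F (f x) x) (hf : Continuous f) (hnonneg : ∀ x, 0 ≤ f x)
    (hbot : Tendsto F atBot (𝓝 m)) (htop : Tendsto F atTop (𝓝 n)) : Integrable f := by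
  refine integrable_of_intervalIntegral_norm_tendsto (l := atTop) (n - m) (a := fun t : ℝ => -t)
    (b := fun t : ℝ => t) (fun i => (hf.integrableOn_Icc).mono_set Set.Ioc_subset_Icc_self)
    tendsto_neg_atTop_atBot tendsto_id ?_
  have h : ∀ t : ℝ, ∫ x in (-t)..t, ‖f x‖ = F t - F (-t) := fun t => by
    simp_rw [Real.norm_of_nonneg (hnonneg _)]
    exact intervalIntegral.integral_eq_sub_of_hasDerivAt (fun x _ => hderiv x)
      (hf.intervalIntegrable _ _)
  simp_rw [h]
  exact htop.sub (hbot.comp tendsto_neg_atTop_atBot)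

lemma one_add_mul_cosh_pos {k : ℝ} (hk : 0 < k) (x : ℝ) : 0 < 1 + k * Real.cosh (2 * x) := by
  have := Real.cosh_pos (2 * x)
  positivity

lemma continuous_inv_one_add_mul_cosh {k : ℝ} (hk : 0 < k) :
    Continuous fun x : ℝ => (1 + k * Real.cosh (2 * x))⁻¹ :=
  Continuous.inv₀ (by fun_prop) fun x => (one_add_mul_cosh_pos hk x).ne'

lemma tendsto_exp_two_mul_atBot : Tendsto (fun x : ℝ => Real.exp (2 * x)) atBot (𝓝 0) :=
  Real.tendsto_exp_atBot.comp (tendsto_id.const_mul_atBot two_pos)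

lemma tendsto_exp_neg_two_mul_atTop : Tendsto (fun x : ℝ => Real.exp (-(2 * x))) atTop (𝓝 0) :=
  Real.tendsto_exp_neg_atTop_nhds_zero.comp (tendsto_id.const_mul_atTop two_pos)

/-- An antiderivative of `1 / (1 + k cosh 2x)`, where `s = √(1 - k²)`. -/
noncomputable def pulsePrimitive (k s x : ℝ) : ℝ :=
  (Real.log (k * Real.exp (2 * x) + 1 - s) - Real.log (k * Real.exp (2 * x) + 1 + s)) / (2 * s)

section Pulse

variable {k s : ℝ}

lemma hasDerivAt_pulsePrimitive (hk : 0 < k) (hs : 0 < s) (hs1 : s < 1) (hks : k ^ 2 + s ^ 2 = 1)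
    (x : ℝ) : HasDerivAt (pulsePrimitive k s) (1 + k * Real.cosh (2 * x))⁻¹ x := by
  have hE : HasDerivAt (fun x : ℝ => k * Real.exp (2 * x)) (k * (Real.exp (2 * x) * 2)) x := by
    simpa using (((hasDerivAt_id x).const_mul 2).exp).const_mul k
  have ht := Real.exp_pos (2 * x)
  have hD := one_add_mul_cosh_pos hk x
  have hkt : 0 < k * Real.exp (2 * x) := by positivity
  have h1 : k * Real.exp (2 * x) + 1 - s ≠ 0 := by linarith
  have h2 : k * Real.exp (2 * x) + 1 + s ≠ 0 := by linarith
  refine ((((hE.add_const 1).sub_const s).log h1).sub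
    (((hE.add_const 1).add_const s).log h2) |>.div_const (2 * s)).congr_deriv ?_
  rw [Real.cosh_eq, Real.exp_neg] at hD ⊢
  generalize Real.exp (2 * x) = t at *
  have hD' : t * 2 + k * (t ^ 2 + 1) ≠ 0 := by positivity
  field_simp
  linear_combination 2 * s * hks

lemma tendsto_pulsePrimitive_atBot (hs : 0 < s) (hs1 : s < 1) :
    Tendsto (pulsePrimitive k s) atBot
      (𝓝 ((Real.log (1 - s) - Real.log (1 + s)) / (2 * s))) := by
  have hE := (tendsto_exp_two_mul_atBot.const_mul k).add_const 1
  rw [mul_zero, zero_add] at hE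
  exact ((((hE.sub_const s).log (by linarith)).sub
    ((hE.add_const s).log (by linarith))).div_const _)

lemma tendsto_pulsePrimitive_atTop (hk : 0 < k) (hs : 0 < s) (hs1 : s < 1) :
    Tendsto (pulsePrimitive k s) atTop (𝓝 0) := by
  have h1 := (tendsto_exp_neg_two_mul_atTop.const_mul (1 - s)).const_add k
  have h2 := (tendsto_exp_neg_two_mul_atTop.const_mul (1 + s)).const_add k
  rw [mul_zero, add_zero] at h1 h2
  have h := (((h1.log hk.ne').sub (h2.log hk.ne')).div_const (2 * s))
  rw [sub_self, zero_div] at h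
  refine h.congr fun x => ?_
  have ht := Real.exp_pos (2 * x)
  have hkt : 0 < k * Real.exp (2 * x) := by positivity
  have e1 : k + (1 - s) * Real.exp (-(2 * x))
      = (k * Real.exp (2 * x) + 1 - s) / Real.exp (2 * x) := by
    rw [Real.exp_neg]; field_simp; ring
  have e2 : k + (1 + s) * Real.exp (-(2 * x))
      = (k * Real.exp (2 * x) + 1 + s) / Real.exp (2 * x) := by
    rw [Real.exp_neg]; field_simp; ring
  rw [pulsePrimitive, e1, e2, Real.log_div (by linarith) ht.ne', Real.log_div (by linarith) ht.ne']
  ring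

lemma log_one_sub_sub_log_one_add (hs : 0 < s) (hs1 : s < 1)
    (hks : k ^ 2 + s ^ 2 = 1) :
    Real.log (1 - s) - Real.log (1 + s) = -(2 * (Real.log (1 + s) - Real.log k)) := by
  have h : (1 - s) * (1 + s) = k ^ 2 := by linear_combination -hks
  have h' := congrArg Real.log h
  rw [Real.log_mul (by linarith) (by linarith), Real.log_pow] at h'
  push_cast at h'
  linarith

lemma integrable_inv_one_add_mul_cosh (hk : 0 < k) (hs : 0 < s) (hs1 : s < 1)
    (hks : k ^ 2 + s ^ 2 = 1) : Integrable fun x : ℝ => (1 + k * Real.cosh (2 * x))⁻¹ :=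
  integrable_of_hasDerivAt_of_nonneg_of_tendsto (hasDerivAt_pulsePrimitive hk hs hs1 hks)
    (continuous_inv_one_add_mul_cosh hk) (fun x => (inv_pos.2 (one_add_mul_cosh_pos hk x)).le)
    (tendsto_pulsePrimitive_atBot hs hs1) (tendsto_pulsePrimitive_atTop hk hs hs1)

lemma integral_inv_one_add_mul_cosh (hk : 0 < k) (hs : 0 < s) (hs1 : s < 1)
    (hks : k ^ 2 + s ^ 2 = 1) :
    ∫ x : ℝ, (1 + k * Real.cosh (2 * x))⁻¹ = (Real.log (1 + s) - Real.log k) / s := by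
  rw [integral_of_hasDerivAt_of_tendsto (hasDerivAt_pulsePrimitive hk hs hs1 hks)
    (integrable_inv_one_add_mul_cosh hk hs hs1 hks)
    (tendsto_pulsePrimitive_atBot hs hs1) (tendsto_pulsePrimitive_atTop hk hs hs1),
    log_one_sub_sub_log_one_add hs hs1 hks]
  field_simp
  ring

lemma hasDerivAt_sinh_div_one_add_mul_cosh (hk : 0 < k) (hks : k ^ 2 + s ^ 2 = 1) (x : ℝ) :
    HasDerivAt (fun x => k * Real.sinh (2 * x) / (1 + k * Real.cosh (2 * x)))
      (2 * ((1 + k * Real.cosh (2 * x))⁻¹ - s ^ 2 * ((1 + k * Real.cosh (2 * x))⁻¹) ^ 2)) x := by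
  have hD := (one_add_mul_cosh_pos hk x).ne'
  have h2 := (hasDerivAt_id x).const_mul 2
  refine ((h2.sinh.const_mul k).div ((h2.cosh.const_mul k).const_add 1) hD).congr_deriv ?_
  have hcs := Real.cosh_sq (2 * x)
  simp only [id_eq, mul_one]
  field_simp
  linear_combination k ^ 2 * hcs + hks

lemma tendsto_sinh_div_one_add_mul_cosh_atBot (hk : 0 < k) :
    Tendsto (fun x : ℝ => k * Real.sinh (2 * x) / (1 + k * Real.cosh (2 * x))) atBot
      (𝓝 (-1)) := by
  have hE := tendsto_exp_two_mul_atBot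
  have h := (((hE.pow 2).sub_const 1).const_mul k).div
    ((hE.const_mul 2).add (((hE.pow 2).add_const 1).const_mul k)) (by simpa using hk.ne')
  have e : k * (0 ^ 2 - 1) / (2 * 0 + k * (0 ^ 2 + 1)) = -1 := by field_simp; norm_num
  rw [e] at h
  refine h.congr fun x => ?_
  have hD := one_add_mul_cosh_pos hk x
  have ht := Real.exp_pos (2 * x)
  simp only [Pi.div_apply]
  rw [Real.cosh_eq, Real.exp_neg] at hD ⊢
  rw [Real.sinh_eq, Real.exp_neg]
  generalize Real.exp (2 * x) = t at *
  have hD' : t * 2 + k * (t ^ 2 + 1) ≠ 0 := by positivity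
  field_simp

lemma tendsto_sinh_div_one_add_mul_cosh_atTop (hk : 0 < k) :
    Tendsto (fun x : ℝ => k * Real.sinh (2 * x) / (1 + k * Real.cosh (2 * x))) atTop (𝓝 1) := by
  have h := ((tendsto_sinh_div_one_add_mul_cosh_atBot hk).comp tendsto_neg_atTop_atBot).neg
  rw [neg_neg] at h
  refine h.congr fun x => ?_
  simp [neg_div]

lemma integral_inv_one_add_mul_cosh_sq (hk : 0 < k) (hs : 0 < s) (hs1 : s < 1)
    (hks : k ^ 2 + s ^ 2 = 1) :
    ∫ x : ℝ, ((1 + k * Real.cosh (2 * x))⁻¹) ^ 2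
      = ((Real.log (1 + s) - Real.log k) / s - 1) / s ^ 2 := by
  have hderiv : ∀ x, HasDerivAt
      (fun x => (pulsePrimitive k s x
        - k * Real.sinh (2 * x) / (1 + k * Real.cosh (2 * x)) / 2) / s ^ 2)
      (((1 + k * Real.cosh (2 * x))⁻¹) ^ 2) x := fun x => by
    refine (((hasDerivAt_pulsePrimitive hk hs hs1 hks x).sub
      ((hasDerivAt_sinh_div_one_add_mul_cosh hk hks x).div_const 2)).div_const
        (s ^ 2)).congr_deriv ?_
    field_simp
    ring
  have hbot := (((tendsto_pulsePrimitive_atBot (k := k) hs hs1).sub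
    ((tendsto_sinh_div_one_add_mul_cosh_atBot hk).div_const 2)).div_const (s ^ 2))
  have htop := (((tendsto_pulsePrimitive_atTop hk hs hs1).sub
    ((tendsto_sinh_div_one_add_mul_cosh_atTop hk).div_const 2)).div_const (s ^ 2))
  rw [integral_of_hasDerivAt_of_tendsto hderiv
    (integrable_of_hasDerivAt_of_nonneg_of_tendsto hderiv
      ((continuous_inv_one_add_mul_cosh hk).pow 2) (fun x => sq_nonneg _) hbot htop) hbot htop,
    log_one_sub_sub_log_one_add hs hs1 hks]
  field_simp
  ring

end Pulse

/-- The function `A(ν) = log ((1 + √(1 - ν)) / √ν) = arcosh (1 / √ν)`. -/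
noncomputable def pulseLog (ν : ℝ) : ℝ := Real.log (1 + Real.sqrt (1 - ν)) - Real.log ν / 2

lemma pulseLog_pos {ν : ℝ} (h0 : 0 < ν) (h1 : ν < 1) : 0 < pulseLog ν := by
  have hs : 0 < Real.sqrt (1 - ν) := Real.sqrt_pos.2 (by linarith)
  have := Real.log_neg h0 h1
  have := Real.log_pos (show 1 < 1 + Real.sqrt (1 - ν) by linarith)
  unfold pulseLog
  linarith

lemma theta_eq {ν : ℝ} (h0 : 0 < ν) (h1 : ν < 1) :
    theta ν = 3 / 4 * (1 - Real.sqrt (1 - ν) / pulseLog ν) := by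
  have hA := pulseLog_pos h0 h1
  have hk : 0 < Real.sqrt ν := Real.sqrt_pos.2 h0
  have hs : 0 < Real.sqrt (1 - ν) := Real.sqrt_pos.2 (by linarith)
  have hk2 : Real.sqrt ν ^ 2 = ν := Real.sq_sqrt h0.le
  have hs2 : Real.sqrt (1 - ν) ^ 2 = 1 - ν := Real.sq_sqrt (by linarith)
  have hs1 : Real.sqrt (1 - ν) < 1 := by
    rw [Real.sqrt_lt' one_pos]; linarith
  have hks : Real.sqrt ν ^ 2 + Real.sqrt (1 - ν) ^ 2 = 1 := by rw [hk2, hs2]; ring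
  have hr2 : ∀ x, r x ν ^ 2 = 3 / 4 * (1 - ν) * (1 + Real.sqrt ν * Real.cosh (2 * x))⁻¹ :=
    fun x => by
      rw [r, R, Real.sq_sqrt, div_eq_mul_inv]
      exact div_nonneg (by linarith) (one_add_mul_cosh_pos hk x).le
  have hr4 : ∀ x, r x ν ^ 4
      = (3 / 4 * (1 - ν)) ^ 2 * ((1 + Real.sqrt ν * Real.cosh (2 * x))⁻¹) ^ 2 := fun x => by
    rw [← mul_pow, ← hr2 x]; ring
  have hlog : Real.log (1 + Real.sqrt (1 - ν)) - Real.log (Real.sqrt ν) = pulseLog ν := by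
    rw [Real.log_sqrt h0.le, pulseLog]
  simp_rw [theta, hr2, hr4, integral_const_mul]
  rw [integral_inv_one_add_mul_cosh hk hs hs1 hks, integral_inv_one_add_mul_cosh_sq hk hs hs1 hks,
    hlog, ← hs2, Real.sqrt_sq hs.le]
  field_simp

lemma hasDerivAt_sqrt_one_sub {ν : ℝ} (h1 : ν < 1) :
    HasDerivAt (fun ν => Real.sqrt (1 - ν)) (-1 / (2 * Real.sqrt (1 - ν))) ν :=
  ((hasDerivAt_id ν).const_sub 1).sqrt (by simp only [id_eq]; linarith)

lemma hasDerivAt_pulseLog {ν : ℝ} (h0 : 0 < ν) (h1 : ν < 1) :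
    HasDerivAt pulseLog (-1 / (2 * ν * Real.sqrt (1 - ν))) ν := by
  have hs : 0 < Real.sqrt (1 - ν) := Real.sqrt_pos.2 (by linarith)
  have hs2 : Real.sqrt (1 - ν) ^ 2 = 1 - ν := Real.sq_sqrt (by linarith)
  refine ((((hasDerivAt_sqrt_one_sub h1).const_add 1).log (by positivity)).sub
    ((Real.hasDerivAt_log h0.ne').div_const 2)).congr_deriv ?_
  field_simp
  linear_combination -hs2

lemma hasDerivAt_theta {ν : ℝ} (h0 : 0 < ν) (h1 : ν < 1) :
    HasDerivAt theta (3 / 8 * (1 / (Real.sqrt (1 - ν) * pulseLog ν) - 1 / (ν * pulseLog ν ^ 2)))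
      ν := by
  have hA := pulseLog_pos h0 h1
  have hs : 0 < Real.sqrt (1 - ν) := Real.sqrt_pos.2 (by linarith)
  have h := ((((hasDerivAt_sqrt_one_sub h1).div (hasDerivAt_pulseLog h0 h1) hA.ne').const_sub
    1).const_mul (3 / 4))
  have heq : theta =ᶠ[𝓝 ν] fun ν => 3 / 4 * (1 - Real.sqrt (1 - ν) / pulseLog ν) := by
    filter_upwards [Ioo_mem_nhds h0 h1] with μ hμ using theta_eq hμ.1 hμ.2
  refine (h.congr_of_eventuallyEq heq).congr_deriv ?_
  field_simp
  ring

lemma four_mul_exp_neg_four_mul_L {ν : ℝ} (h0 : 0 < ν) : 4 * Real.exp (-4 * L ν) = ν := by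
  rw [show -4 * L ν = -Real.log (4 / ν) by unfold L; ring, Real.exp_neg,
    Real.exp_log (by positivity)]
  field_simp

lemma hasDerivAt_theta_comp_exp {ν : ℝ} (h0 : 0 < ν) (h1 : ν < 1) :
    HasDerivAt (fun l => theta (4 * Real.exp (-4 * l)))
      (3 / 2 * (1 / pulseLog ν ^ 2 - ν / (Real.sqrt (1 - ν) * pulseLog ν))) (L ν) := by
  have hA := pulseLog_pos h0 h1
  have hs : 0 < Real.sqrt (1 - ν) := Real.sqrt_pos.2 (by linarith)
  have hν := four_mul_exp_neg_four_mul_L h0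
  have hin : HasDerivAt (fun l : ℝ => 4 * Real.exp (-4 * l)) (-4 * ν) (L ν) := by
    refine ((((hasDerivAt_id (L ν)).const_mul (-4)).exp).const_mul 4).congr_deriv ?_
    simp only [id_eq]
    linear_combination (-4) * hν
  have hout := hasDerivAt_theta h0 h1
  rw [← hν] at hout
  refine (HasDerivAt.comp (L ν) hout hin).congr_deriv ?_
  rw [hν]
  field_simp
  ring

lemma abs_pulseLog_sub_two_mul_L_le {ν : ℝ} (h0 : 0 < ν) (h1 : ν < 1) :
    |pulseLog ν - 2 * L ν| ≤ ν := by
  have hs : 0 < Real.sqrt (1 - ν) := Real.sqrt_pos.2 (by linarith)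
  have hs2 : Real.sqrt (1 - ν) ^ 2 = 1 - ν := Real.sq_sqrt (by linarith)
  have hs1 : Real.sqrt (1 - ν) ≤ 1 := by rw [Real.sqrt_le_one]; linarith
  have h4 : Real.log 4 = 2 * Real.log 2 := by
    rw [show (4 : ℝ) = 2 ^ 2 by norm_num, Real.log_pow]; norm_num
  have hd : pulseLog ν - 2 * L ν = -Real.log (2 / (1 + Real.sqrt (1 - ν))) := by
    rw [pulseLog, L, Real.log_div (by norm_num) h0.ne', Real.log_div (by norm_num) (by positivity),
      h4]
    ring
  rw [hd, abs_neg, abs_of_nonneg (Real.log_nonneg (by rw [le_div_iff₀ (by positivity)]; linarith))]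
  refine (Real.log_le_sub_one_of_pos (by positivity)).trans ?_
  rw [sub_le_iff_le_add, div_le_iff₀ (by positivity)]
  nlinarith

lemma one_lt_two_mul_L {ν : ℝ} (h0 : 0 < ν) (h1 : ν < 1 / 100) : 1 < 2 * L ν := by
  have h : 2 < Real.log (4 / ν) := by
    rw [Real.lt_log_iff_exp_lt (by positivity)]
    have h3 : Real.exp 2 < 400 := by
      have := Real.exp_one_lt_d9
      have e : Real.exp 2 = Real.exp 1 * Real.exp 1 := by rw [← Real.exp_add]; norm_num
      nlinarith [Real.exp_pos 1]
    refine h3.trans ?_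
    rw [lt_div_iff₀ h0]
    linarith
  unfold L
  linarith

lemma abs_one_div_sub_div_le {A B s ν : ℝ} (hB : 1 < B) (hAB : |A - B| ≤ ν) (hν : ν < 1 / 100)
    (hs : 1 - ν ≤ s) (hs1 : s ≤ 1) : |1 / B - s / A| ≤ 4 * ν := by
  have hν0 : 0 ≤ ν := (abs_nonneg _).trans hAB
  obtain ⟨hl, hu⟩ := abs_le.1 hAB
  have hA : B / 2 ≤ A := by linarith
  have hA0 : 0 < A := by linarith
  have hB0 : 0 < B := by linarith
  have e : 1 / B - s / A = (A - s * B) / (A * B) := by field_simp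
  have hnum : |A - s * B| ≤ 2 * ν * B := by
    rw [abs_le]
    constructor <;> nlinarith
  have hden : B / 2 ≤ A * B := by nlinarith
  rw [e, abs_div, abs_of_pos (mul_pos hA0 hB0), div_le_iff₀ (mul_pos hA0 hB0)]
  nlinarith

lemma abs_one_div_sq_sub_le {A B s ν : ℝ} (hB : 1 < B) (hAB : |A - B| ≤ ν) (hν : ν < 1 / 100)
    (hs : 1 - ν ≤ s) : |1 / A ^ 2 - ν / (s * A) - 1 / B ^ 2| ≤ 16 * ν / B := by
  have hν0 : 0 ≤ ν := (abs_nonneg _).trans hAB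
  obtain ⟨hl, hu⟩ := abs_le.1 hAB
  have hA : B / 2 ≤ A := by linarith
  have hA0 : 0 < A := by linarith
  have hB0 : 0 < B := by linarith
  have hs0 : 0 < s := by linarith
  have e : 1 / A ^ 2 - 1 / B ^ 2 = (B - A) * (A + B) / (A ^ 2 * B ^ 2) := by
    field_simp
    ring
  have hsq : |1 / A ^ 2 - 1 / B ^ 2| ≤ 12 * ν / B := by
    have hden : B ^ 2 / 4 ≤ A ^ 2 := by nlinarith
    have hsum : (A + B) * B ≤ 12 * (A ^ 2 * B ^ 2) := by
      have h1 : (A + B) * B ≤ 3 * B ^ 2 := by nlinarith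
      have h2 : 3 * B ^ 2 ≤ 12 * A ^ 2 := by linarith
      have h3 : A ^ 2 ≤ A ^ 2 * B ^ 2 := le_mul_of_one_le_right (sq_nonneg A) (by nlinarith)
      linarith
    rw [e, abs_div, abs_mul, abs_sub_comm, abs_of_pos (add_pos hA0 hB0),
      abs_of_pos (show 0 < A ^ 2 * B ^ 2 by positivity), div_le_div_iff₀ (by positivity) hB0]
    calc |A - B| * (A + B) * B = |A - B| * ((A + B) * B) := by ring
      _ ≤ ν * (12 * (A ^ 2 * B ^ 2)) := by gcongr
      _ = 12 * ν * (A ^ 2 * B ^ 2) := by ring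
  have hlin : |ν / (s * A)| ≤ 4 * ν / B := by
    have h : B ≤ 4 * (s * A) := by nlinarith
    rw [abs_of_nonneg (by positivity), div_le_div_iff₀ (by positivity) hB0]
    nlinarith
  calc |1 / A ^ 2 - ν / (s * A) - 1 / B ^ 2|
      = |1 / A ^ 2 - 1 / B ^ 2 - ν / (s * A)| := by ring_nf
    _ ≤ |1 / A ^ 2 - 1 / B ^ 2| + |ν / (s * A)| := abs_sub _ _
    _ ≤ 12 * ν / B + 4 * ν / B := add_le_add hsq hlin
    _ = 16 * ν / B := by ring

/-- `|θ(ν) − 3/4 + 3/(8L)| ≤ C√ν`, the function `L ↦ θ(4e^{−4L})` is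
differentiable, and its derivative `θ₁` satisfies `|θ₁ − 3/(8L²)| ≤ C√ν/L`. -/
theorem theta_asymptotics :
    ∃ C > 0, ∃ ν₀ ∈ Set.Ioo (0 : ℝ) 1, ∀ ν ∈ Set.Ioo (0 : ℝ) ν₀,
      |theta ν - 3 / 4 + 3 / (8 * L ν)| ≤ C * Real.sqrt ν ∧
      DifferentiableAt ℝ (fun l => theta (4 * Real.exp (-4 * l))) (L ν) ∧
      |deriv (fun l => theta (4 * Real.exp (-4 * l))) (L ν) - 3 / (8 * L ν ^ 2)|
        ≤ C * Real.sqrt ν / L ν := by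
  refine ⟨12, by norm_num, 1 / 100, ⟨by norm_num, by norm_num⟩, fun ν ⟨h0, hν⟩ => ?_⟩
  have h1 : ν < 1 := by linarith
  have hder := hasDerivAt_theta_comp_exp h0 h1
  have hB := one_lt_two_mul_L h0 hν
  have hL : 0 < L ν := by linarith
  have hAB := abs_pulseLog_sub_two_mul_L_le h0 h1
  have hs : 1 - ν ≤ Real.sqrt (1 - ν) := Real.le_sqrt_of_sq_le (by nlinarith)
  have hs1 : Real.sqrt (1 - ν) ≤ 1 := by rw [Real.sqrt_le_one]; linarith
  have hk : ν ≤ Real.sqrt ν := Real.le_sqrt_of_sq_le (by nlinarith)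
  refine ⟨?_, hder.differentiableAt, ?_⟩
  · rw [theta_eq h0 h1,
      show 3 / 4 * (1 - Real.sqrt (1 - ν) / pulseLog ν) - 3 / 4 + 3 / (8 * L ν)
        = 3 / 4 * (1 / (2 * L ν) - Real.sqrt (1 - ν) / pulseLog ν) by field_simp; ring,
      abs_mul, abs_of_pos (by norm_num : (0 : ℝ) < 3 / 4)]
    linarith [abs_one_div_sub_div_le hB hAB hν hs hs1]
  · rw [hder.deriv,
      show 3 / 2 * (1 / pulseLog ν ^ 2 - ν / (Real.sqrt (1 - ν) * pulseLog ν)) - 3 / (8 * L ν ^ 2)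
        = 3 / 2 * (1 / pulseLog ν ^ 2 - ν / (Real.sqrt (1 - ν) * pulseLog ν)
          - 1 / (2 * L ν) ^ 2) by ring,
      abs_mul, abs_of_pos (by norm_num : (0 : ℝ) < 3 / 2)]
    calc 3 / 2 * |1 / pulseLog ν ^ 2 - ν / (Real.sqrt (1 - ν) * pulseLog ν) - 1 / (2 * L ν) ^ 2|
        ≤ 3 / 2 * (16 * ν / (2 * L ν)) := by
          gcongr
          exact abs_one_div_sq_sub_le hB hAB hν hs
      _ = 12 * ν / L ν := by field_simp; norm_num
      _ ≤ 12 * Real.sqrt ν / L ν := by gcongr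
end

section
/- Let X and Z be Banach spaces, U a neighborhood of x₀ ∈ X, and f : U → Z a C² function. Let z₀ = f(x₀) and A = Df(x₀), and assume A has a bounded inverse A⁻¹. Let ρ > 0 be such that the closed ball of center x₀ and radius ρ is contained in U, and set M = sup_{‖ξ‖≤ρ} ‖A⁻¹ ∘ D²f(x₀+ξ)‖, a = min(1, 1/(2ρM)), K = 3aρ/4. If ‖A⁻¹ z₀‖ ≤ K, then the equation f(x) = 0 has a unique solution x in the closed ball {x : ‖x − x₀‖ ≤ aρ}; moreover this solution satisfies ‖x − x₀‖ ≤ 2‖A⁻¹ z₀‖ and ‖x − x₀ + A⁻¹ z₀‖ ≤ 2M‖A⁻¹ z₀‖². -/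
/-- Second-order Taylor estimate for a map with a critical point at `x₀` whose derivative is
`M`-Lipschitz at `x₀`. -/
theorem norm_image_sub_le_of_norm_fderiv_le_mul_norm
    {E F : Type*} [NormedAddCommGroup E] [NormedSpace ℝ E]
    [NormedAddCommGroup F] [NormedSpace ℝ F]
    {g : E → F} {g' : E → E →L[ℝ] F} {x₀ : E} {r M : ℝ}
    (hg : ∀ x ∈ Metric.closedBall x₀ r, HasFDerivAt g (g' x) x)
    (hg' : ∀ x ∈ Metric.closedBall x₀ r, ‖g' x‖ ≤ M * ‖x - x₀‖)
    {x : E} (hx : x ∈ Metric.closedBall x₀ r) :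
    ‖g x - g x₀‖ ≤ M * ‖x - x₀‖ ^ 2 / 2 := by
  set v := x - x₀ with hv
  have hvr : ‖v‖ ≤ r := by simpa [hv, dist_eq_norm] using hx
  have hmem : ∀ t ∈ Set.Icc (0 : ℝ) 1, x₀ + t • v ∈ Metric.closedBall x₀ r := by
    intro t ht
    rw [mem_closedBall_iff_norm, add_sub_cancel_left, norm_smul, Real.norm_of_nonneg ht.1]
    exact (mul_le_of_le_one_left (norm_nonneg _) ht.2).trans hvr
  have hderiv : ∀ t ∈ Set.Icc (0 : ℝ) 1,
      HasDerivAt (fun t : ℝ => g (x₀ + t • v) - g x₀) (g' (x₀ + t • v) v) t := by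
    intro t ht
    have hline : HasDerivAt (fun t : ℝ => x₀ + t • v) v t := by
      simpa using ((hasDerivAt_id t).smul_const v).const_add x₀
    exact ((hg _ (hmem t ht)).comp_hasDerivAt t hline).sub_const _
  have hB : ∀ t : ℝ, HasDerivAt (fun t => M * ‖v‖ ^ 2 * t ^ 2 / 2) (M * ‖v‖ ^ 2 * t) t := by
    intro t
    refine (((hasDerivAt_pow 2 t).const_mul (M * ‖v‖ ^ 2)).div_const 2).congr_deriv ?_
    norm_num
    ring
  have h := image_norm_le_of_norm_deriv_right_le_deriv_boundary
    (f := fun t : ℝ => g (x₀ + t • v) - g x₀) (a := 0) (b := 1)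
    (fun t ht => (hderiv t ht).continuousAt.continuousWithinAt)
    (fun t ht => (hderiv t (Set.Ico_subset_Icc_self ht)).hasDerivWithinAt)
    (by simp) hB
    (fun t ht => by
      have ht' := Set.Ico_subset_Icc_self ht
      calc ‖g' (x₀ + t • v) v‖ ≤ ‖g' (x₀ + t • v)‖ * ‖v‖ := ContinuousLinearMap.le_opNorm _ _
        _ ≤ M * ‖x₀ + t • v - x₀‖ * ‖v‖ := by gcongr; exact hg' _ (hmem t ht')
        _ = M * ‖v‖ ^ 2 * t := by
          rw [add_sub_cancel_left, norm_smul, Real.norm_of_nonneg ht.1]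
          ring)
    (Set.right_mem_Icc.2 zero_le_one)
  simpa [hv] using h

/-- The fixed point statement for `x ↦ x - h x` when the derivative of `h` is the identity at `x₀`
and `M`-Lipschitz there. -/
theorem existsUnique_zero_of_norm_id_sub_fderiv_le
    {E : Type*} [NormedAddCommGroup E] [NormedSpace ℝ E] [CompleteSpace E]
    {h : E → E} {h' : E → E →L[ℝ] E} {x₀ : E} {r M : ℝ} (hr : 0 ≤ r) (hM : 0 ≤ M)
    (hMr : M * r ≤ 1 / 2)
    (hh : ∀ x ∈ Metric.closedBall x₀ r, HasFDerivAt h (h' x) x)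
    (hh' : ∀ x ∈ Metric.closedBall x₀ r,
      ‖ContinuousLinearMap.id ℝ E - h' x‖ ≤ M * ‖x - x₀‖)
    (h₀ : ‖h x₀‖ ≤ 3 * r / 4) :
    (∃! x : E, ‖x - x₀‖ ≤ r ∧ h x = 0) ∧
    ∀ x : E, ‖x - x₀‖ ≤ r → h x = 0 →
      ‖x - x₀‖ ≤ 2 * ‖h x₀‖ ∧ ‖x - x₀ + h x₀‖ ≤ 2 * M * ‖h x₀‖ ^ 2 := by
  set g : E → E := fun x => x - h x with hg_def
  have hg : ∀ x ∈ Metric.closedBall x₀ r,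
      HasFDerivAt g (ContinuousLinearMap.id ℝ E - h' x) x :=
    fun x hx => (hasFDerivAt_id x).sub (hh x hx)
  have hquad : ∀ x ∈ Metric.closedBall x₀ r, ‖g x - g x₀‖ ≤ M * ‖x - x₀‖ ^ 2 / 2 :=
    fun x hx => norm_image_sub_le_of_norm_fderiv_le_mul_norm hg hh' hx
  have hlip : LipschitzOnWith (1 / 2) g (Metric.closedBall x₀ r) := by
    refine (convex_closedBall x₀ r).lipschitzOnWith_of_nnnorm_hasFDerivWithin_le
      (fun x hx => (hg x hx).hasFDerivWithinAt) fun x hx => ?_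
    rw [← NNReal.coe_le_coe, coe_nnnorm]
    calc _ ≤ M * ‖x - x₀‖ := hh' x hx
      _ ≤ M * r := by gcongr; exact mem_closedBall_iff_norm.1 hx
      _ ≤ _ := by simpa using hMr
  have hmaps : Set.MapsTo g (Metric.closedBall x₀ r) (Metric.closedBall x₀ r) := by
    intro x hx
    have hxr := mem_closedBall_iff_norm.1 hx
    rw [mem_closedBall_iff_norm]
    have h1 : M * ‖x - x₀‖ ^ 2 / 2 ≤ r / 4 := by
      have : M * ‖x - x₀‖ ^ 2 ≤ M * r ^ 2 := by gcongr
      nlinarith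
    calc ‖g x - x₀‖ = ‖(g x - g x₀) - h x₀‖ := by congr 1; simp only [hg_def]; abel
      _ ≤ ‖g x - g x₀‖ + ‖h x₀‖ := norm_sub_le _ _
      _ ≤ r := by linarith [hquad x hx]
  have hcontr : ContractingWith (1 / 2) (hmaps.restrict g _ _) :=
    ⟨by rw [← NNReal.coe_lt_coe]; norm_num, hlip.mapsToRestrict hmaps⟩
  have hx₀ : x₀ ∈ Metric.closedBall x₀ r := Metric.mem_closedBall_self hr
  obtain ⟨x, hx, hfix, -⟩ := hcontr.exists_fixedPoint' Metric.isClosed_closedBall.isComplete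
    hmaps hx₀ (edist_ne_top _ _)
  refine ⟨⟨x, ⟨mem_closedBall_iff_norm.1 hx, ?_⟩, ?_⟩, ?_⟩
  · simpa [hg_def, Function.IsFixedPt] using hfix
  · rintro y ⟨hy, hy0⟩
    have hx0 : h x = 0 := by simpa [hg_def, Function.IsFixedPt] using hfix
    have := hlip.dist_le_mul y (mem_closedBall_iff_norm.2 hy) x hx
    simp only [hg_def, hy0, hx0, sub_zero, NNReal.coe_div, NNReal.coe_one,
      NNReal.coe_ofNat] at this
    exact dist_le_zero.1 (by linarith)
  · intro y hy hy0
    have hgy : g y - g x₀ = y - x₀ + h x₀ := by simp only [hg_def, hy0]; abel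
    have hq := hquad y (mem_closedBall_iff_norm.2 hy)
    rw [hgy] at hq
    have hle : ‖y - x₀‖ ≤ ‖y - x₀ + h x₀‖ + ‖h x₀‖ := by
      simpa using norm_sub_le (y - x₀ + h x₀) (h x₀)
    have hMy : M * ‖y - x₀‖ ≤ 1 / 2 := (by gcongr : M * ‖y - x₀‖ ≤ M * r).trans hMr
    have h2 : ‖y - x₀‖ ≤ 2 * ‖h x₀‖ := by
      nlinarith [norm_nonneg (y - x₀), norm_nonneg (h x₀)]
    refine ⟨h2, hq.trans ?_⟩
    have : M * ‖y - x₀‖ ^ 2 ≤ M * (2 * ‖h x₀‖) ^ 2 := by gcongr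
    linarith


/-- an implicit function theorem with estimates. If `f` is `C²` near `x₀`,
`A = Df(x₀)` is invertible, `M` bounds `‖A⁻¹ ∘ D²f‖` on the ball of radius `ρ`,
`a = min(1, 1/(2ρM))`, `K = 3aρ/4`, and `‖A⁻¹f(x₀)‖ ≤ K`, then `f` has a unique zero
in the closed ball of radius `aρ` around `x₀`, and this zero `x` satisfies
`‖x − x₀‖ ≤ 2‖A⁻¹f(x₀)‖` and `‖x − x₀ + A⁻¹f(x₀)‖ ≤ 2M‖A⁻¹f(x₀)‖²`. -/
theorem implicit_function_with_estimates
    {X Z : Type*} [NormedAddCommGroup X] [NormedSpace ℝ X] [CompleteSpace X]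
    [NormedAddCommGroup Z] [NormedSpace ℝ Z] [CompleteSpace Z]
    (U : Set X) (hU : IsOpen U) (x₀ : X) (hx₀ : x₀ ∈ U)
    (f : X → Z) (hf : ContDiffOn ℝ 2 f U)
    (A : X ≃L[ℝ] Z) (hA : (A : X →L[ℝ] Z) = fderiv ℝ f x₀)
    (ρ : ℝ) (hρ : 0 < ρ) (hball : Metric.closedBall x₀ ρ ⊆ U)
    (M : ℝ)
    (hM : M = sSup {c : ℝ | ∃ ξ : X, ‖ξ‖ ≤ ρ ∧
      c = ‖((ContinuousLinearMap.compL ℝ X Z X (A.symm : Z →L[ℝ] X)).comp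
        (fderiv ℝ (fderiv ℝ f) (x₀ + ξ)))‖})
    (a K : ℝ) (ha : a = min 1 (1 / (2 * ρ * M))) (hK : K = 3 * a * ρ / 4)
    (hz₀ : ‖A.symm (f x₀)‖ ≤ K) :
    (∃! x : X, ‖x - x₀‖ ≤ a * ρ ∧ f x = 0) ∧
    ∀ x : X, ‖x - x₀‖ ≤ a * ρ → f x = 0 →
      ‖x - x₀‖ ≤ 2 * ‖A.symm (f x₀)‖ ∧
      ‖x - x₀ + A.symm (f x₀)‖ ≤ 2 * M * ‖A.symm (f x₀)‖ ^ 2 := by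
  set S := {c : ℝ | ∃ ξ : X, ‖ξ‖ ≤ ρ ∧
      c = ‖((ContinuousLinearMap.compL ℝ X Z X (A.symm : Z →L[ℝ] X)).comp
        (fderiv ℝ (fderiv ℝ f) (x₀ + ξ)))‖} with hS
  have hM0 : 0 ≤ M := hM ▸ Real.sSup_nonneg (by rintro _ ⟨ξ, -, rfl⟩; exact norm_nonneg _)
  -- When `M = 0`, which includes the case of an unbounded second derivative, `a = 0`.
  rcases hM0.eq_or_lt with hM_zero | hM_pos
  · have ha0 : a = 0 := by simp [ha, ← hM_zero]
    have hfx₀ : f x₀ = 0 := by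
      have : ‖A.symm (f x₀)‖ ≤ 0 := by simpa [hK, ha0] using hz₀
      simpa using this
    simp only [ha0, zero_mul, norm_le_zero_iff, sub_eq_zero]
    exact ⟨⟨x₀, ⟨rfl, hfx₀⟩, fun y hy => hy.1⟩, by rintro x rfl -; simp [hfx₀]⟩
  have hbdd : BddAbove S := by
    by_contra hS'
    rw [Real.sSup_of_not_bddAbove hS'] at hM
    exact hM_pos.ne' hM
  have ha_pos : 0 < a := by rw [ha]; positivity
  have ha_one : a ≤ 1 := ha ▸ min_le_left _ _
  have haM : M * (a * ρ) ≤ 1 / 2 := by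
    have h1 : a ≤ 1 / (2 * ρ * M) := ha ▸ min_le_right _ _
    rw [le_div_iff₀ (by positivity)] at h1
    linarith
  have haρ : a * ρ ≤ ρ := mul_le_of_le_one_left hρ.le ha_one
  set L := ContinuousLinearMap.compL ℝ X Z X (A.symm : Z →L[ℝ] X)
  have hcd : ∀ x ∈ Metric.closedBall x₀ ρ, ContDiffAt ℝ 2 f x :=
    fun x hx => hf.contDiffAt (hU.mem_nhds (hball hx))
  have hd1 : ∀ x ∈ Metric.closedBall x₀ ρ,
      HasFDerivAt (fun x => A.symm (f x)) (L (fderiv ℝ f x)) x := fun x hx =>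
    (A.symm : Z →L[ℝ] X).hasFDerivAt.comp x
      ((hcd x hx).differentiableAt (by norm_num)).hasFDerivAt
  have hd2 : ∀ x ∈ Metric.closedBall x₀ ρ,
      HasFDerivAt (fun x => L (fderiv ℝ f x)) (L.comp (fderiv ℝ (fderiv ℝ f) x)) x :=
    fun x hx => L.hasFDerivAt.comp x
      (((hcd x hx).fderiv_right (m := 1) (by norm_num)).differentiableAt
        (by norm_num)).hasFDerivAt
  have hbound : ∀ x ∈ Metric.closedBall x₀ ρ, ‖L.comp (fderiv ℝ (fderiv ℝ f) x)‖ ≤ M := by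
    intro x hx
    rw [hM]
    exact le_csSup hbdd ⟨x - x₀, mem_closedBall_iff_norm.1 hx, by rw [add_sub_cancel]⟩
  have hid : L (fderiv ℝ f x₀) = ContinuousLinearMap.id ℝ X := by
    rw [← hA]
    ext x
    simp [L]
  have hlip : ∀ x ∈ Metric.closedBall x₀ ρ,
      ‖ContinuousLinearMap.id ℝ X - L (fderiv ℝ f x)‖ ≤ M * ‖x - x₀‖ := by
    intro x hx
    rw [← hid, norm_sub_rev]
    exact (convex_closedBall x₀ ρ).norm_image_sub_le_of_norm_hasFDerivWithin_le
      (fun y hy => (hd2 y hy).hasFDerivWithinAt) hbound (Metric.mem_closedBall_self hρ.le) hx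
  have hsub := Metric.closedBall_subset_closedBall (x := x₀) haρ
  simpa using existsUnique_zero_of_norm_id_sub_fderiv_le (by positivity) hM0 haM
    (fun x hx => hd1 x (hsub hx)) (fun x hx => hlip x (hsub hx))
    (hz₀.trans_eq (by rw [hK]; ring))
end
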